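/- Let $M$ be an $n\times n$ random matrix whose entries are i.i.d., each taking the value $0$ with probability $1/2$ and each of the values $1$ and $-1$ with probability $1/4$, and let $X$ denote the number of positive divisors of $\det M$ when $\det M\ne 0$, with the convention $X=1$ when $\det M=0$. Then there exists an absolute constant $C>0$ such that for all $n\ge 2$, $\mathbb{E}[\log X]\le C(\log n)^{2}$. -/

import Mathlib

open MeasureTheory

/-- The law of a single entry: `0` with probability `1/2`, `1` and `-1` with
probability `1/4` each. -/
noncomputable def entryMeasure : Measure ℤ :=
  (1/2 : ENNReal) • Measure.dirac 0 + (1/4 : ENNReal) • Measure.dirac 1 +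
    (1/4 : ENNReal) • Measure.dirac (-1)

instance : IsProbabilityMeasure entryMeasure := by
  constructor
  simp only [entryMeasure, Measure.add_apply, Measure.smul_apply, measure_univ, smul_eq_mul,
    mul_one, one_div]
  have h4 : (4⁻¹ + 4⁻¹ : ENNReal) = 2⁻¹ := by
    rw [← two_mul, show (4 : ENNReal) = 2 * 2 by norm_num,
      ENNReal.mul_inv (by norm_num) (by norm_num), ← mul_assoc,
      ENNReal.mul_inv_cancel (by norm_num) (by norm_num), one_mul]
  rw [add_assoc, h4, ENNReal.inv_two_add_inv_two]

/-- The joint law of `n` i.i.d. entries. -/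
noncomputable def vecMeasure (n : ℕ) : Measure (Fin n → ℤ) :=
  Measure.pi fun _ => entryMeasure

instance (n : ℕ) : IsProbabilityMeasure (vecMeasure n) := by
  unfold vecMeasure; infer_instance

/-- The law of an `n × n` random matrix (given as a function of its rows) with
i.i.d. entries distributed according to `entryMeasure`. -/
noncomputable def matMeasure (n : ℕ) : Measure (Fin n → Fin n → ℤ) :=
  Measure.pi fun _ => vecMeasure n

instance (n : ℕ) : IsProbabilityMeasure (matMeasure n) := by
  unfold matMeasure; infer_instance

namespace DetDivisors

open Finset

/-- The expectation of `f` under the weight `w` on a finite type. -/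
noncomputable def expect {Ω : Type*} [Fintype Ω] (w f : Ω → ℝ) : ℝ := ∑ x, w x * f x

/-- The product weight on a finite power. -/
noncomputable def prodWeight {ι Ω : Type*} [Fintype ι] (w : Ω → ℝ) (x : ι → Ω) : ℝ :=
  ∏ i, w (x i)

/-- A probability weight on a finite type. -/
structure IsWeight {Ω : Type*} [Fintype Ω] (w : Ω → ℝ) : Prop where
  nonneg : ∀ x, 0 ≤ w x
  sum_eq_one : ∑ x, w x = 1

open Classical in
/-- The indicator of a proposition, as a real number. -/
noncomputable def ind (P : Prop) : ℝ := if P then 1 else 0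

/-- The probability of the event `E` under the weight `w`. -/
noncomputable def prob {Ω : Type*} [Fintype Ω] (w : Ω → ℝ) (E : Ω → Prop) : ℝ :=
  expect w fun x => ind (E x)

section Indicator

variable {P Q : Prop}

lemma ind_of_true (h : P) : ind P = 1 := by simp [ind, h]

lemma ind_of_false (h : ¬ P) : ind P = 0 := by simp [ind, h]

lemma ind_nonneg (P : Prop) : 0 ≤ ind P := by unfold ind; split_ifs <;> norm_num

lemma ind_le_one (P : Prop) : ind P ≤ 1 := by unfold ind; split_ifs <;> norm_num

lemma ind_mono (h : P → Q) : ind P ≤ ind Q := by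
  by_cases hP : P
  · rw [ind_of_true hP, ind_of_true (h hP)]
  · rw [ind_of_false hP]; exact ind_nonneg Q

lemma ind_and : ind (P ∧ Q) = ind P * ind Q := by
  by_cases hP : P <;> by_cases hQ : Q <;> simp [ind, hP, hQ]

lemma ind_or_le : ind (P ∨ Q) ≤ ind P + ind Q := by
  by_cases hP : P <;> by_cases hQ : Q <;> simp [ind, hP, hQ]

lemma ind_exists_le {α : Type*} (s : Finset α) (R : α → Prop) :
    ind (∃ a ∈ s, R a) ≤ ∑ a ∈ s, ind (R a) := by
  by_cases h : ∃ a ∈ s, R a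
  · obtain ⟨a, ha, hR⟩ := h
    rw [ind_of_true ⟨a, ha, hR⟩, ← ind_of_true hR]
    exact single_le_sum (f := fun a => ind (R a)) (fun _ _ => ind_nonneg _) ha
  · rw [ind_of_false h]
    exact sum_nonneg fun _ _ => ind_nonneg _

lemma prod_ind {α : Type*} (s : Finset α) (R : α → Prop) :
    ∏ a ∈ s, ind (R a) = ind (∀ a ∈ s, R a) := by
  by_cases h : ∀ a ∈ s, R a
  · rw [ind_of_true h]
    exact prod_eq_one fun a ha => ind_of_true (h a ha)
  · rw [ind_of_false h]
    push Not at h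
    obtain ⟨a, ha, hR⟩ := h
    exact prod_eq_zero ha (ind_of_false hR)

end Indicator

section Expectation

variable {Ω Ω' ι : Type*} [Fintype Ω] [Fintype Ω'] [Fintype ι] {w f g : Ω → ℝ}

lemma expect_mono (hw : IsWeight w) (h : ∀ x, f x ≤ g x) : expect w f ≤ expect w g :=
  sum_le_sum fun x _ => mul_le_mul_of_nonneg_left (h x) (hw.nonneg x)

lemma expect_nonneg (hw : IsWeight w) (h : ∀ x, 0 ≤ f x) : 0 ≤ expect w f :=
  sum_nonneg fun x _ => mul_nonneg (hw.nonneg x) (h x)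

lemma expect_const (hw : IsWeight w) (c : ℝ) : expect w (fun _ => c) = c := by
  simp [expect, ← sum_mul, hw.sum_eq_one]

lemma expect_add : expect w (fun x => f x + g x) = expect w f + expect w g := by
  simp [expect, mul_add, sum_add_distrib]

lemma expect_mul_left (c : ℝ) : expect w (fun x => c * f x) = c * expect w f := by
  simp only [expect, mul_sum]
  exact sum_congr rfl fun _ _ => by ring

lemma expect_mul_right (c : ℝ) : expect w (fun x => f x * c) = expect w f * c := by
  simp only [expect, sum_mul]
  exact sum_congr rfl fun _ _ => by ring

lemma expect_sum {α : Type*} (s : Finset α) (F : α → Ω → ℝ) :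
    expect w (fun x => ∑ a ∈ s, F a x) = ∑ a ∈ s, expect w (F a) := by
  simp only [expect, mul_sum]
  exact sum_comm

lemma expect_comm (v : Ω' → ℝ) (F : Ω → Ω' → ℝ) :
    expect w (fun x => expect v fun y => F x y) = expect v fun y => expect w fun x => F x y := by
  simp only [expect, mul_sum]
  rw [sum_comm]
  exact sum_congr rfl fun _ _ => sum_congr rfl fun _ _ => by ring

lemma prob_nonneg (hw : IsWeight w) (E : Ω → Prop) : 0 ≤ prob w E :=
  expect_nonneg hw fun _ => ind_nonneg _

lemma prob_le_one (hw : IsWeight w) (E : Ω → Prop) : prob w E ≤ 1 :=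
  (expect_mono hw fun _ => ind_le_one _).trans_eq (expect_const hw 1)

lemma prob_mono (hw : IsWeight w) {E E' : Ω → Prop} (h : ∀ x, E x → E' x) :
    prob w E ≤ prob w E' :=
  expect_mono hw fun x => ind_mono (h x)

lemma prob_exists_le (hw : IsWeight w) {α : Type*} (s : Finset α) (E : α → Ω → Prop) :
    prob w (fun x => ∃ a ∈ s, E a x) ≤ ∑ a ∈ s, prob w (E a) := by
  unfold prob
  rw [← expect_sum]
  exact expect_mono hw fun x => ind_exists_le s fun a => E a x

lemma prob_or_le (hw : IsWeight w) (E E' : Ω → Prop) :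
    prob w (fun x => E x ∨ E' x) ≤ prob w E + prob w E' := by
  unfold prob
  rw [← expect_add]
  exact expect_mono hw fun x => ind_or_le

lemma IsWeight.prodWeight [DecidableEq ι] (hw : IsWeight w) :
    IsWeight (prodWeight w : (ι → Ω) → ℝ) where
  nonneg x := prod_nonneg fun i _ => hw.nonneg (x i)
  sum_eq_one := by
    have := Finset.prod_univ_sum (fun _ : ι => (univ : Finset Ω)) (fun _ a => w a)
    simp only [hw.sum_eq_one, prod_const_one, Fintype.piFinset_univ] at this
    exact this.symm

lemma expect_cons {n : ℕ} (f : (Fin (n + 1) → Ω) → ℝ) :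
    expect (prodWeight w) f =
      expect w fun x => expect (prodWeight w) fun y => f (Fin.cons x y) := by
  unfold expect
  rw [← (Fin.consEquiv fun _ => Ω).sum_comp, Fintype.sum_prod_type]
  simp only [mul_sum]
  refine sum_congr rfl fun x _ => sum_congr rfl fun y _ => ?_
  simp [Fin.consEquiv, prodWeight, Fin.prod_univ_succ, mul_assoc]

lemma expect_resample [DecidableEq ι] (hw : IsWeight w) (j : ι) (f : (ι → Ω) → ℝ) :
    expect (prodWeight w) f =
      expect (prodWeight w) fun X => expect w fun x => f (Function.update X j x) := by
  have key : ∀ (X : ι → Ω) (x : Ω),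
      prodWeight w X * w x = prodWeight w (Function.update X j x) * w (X j) := by
    intro X x
    unfold prodWeight
    rw [← mul_prod_erase _ _ (mem_univ j), ← mul_prod_erase univ
      (fun i => w (Function.update X j x i)) (mem_univ j)]
    have : ∏ i ∈ univ.erase j, w (Function.update X j x i) = ∏ i ∈ univ.erase j, w (X i) :=
      prod_congr rfl fun i hi => by rw [Function.update_of_ne (ne_of_mem_erase hi)]
    rw [this, Function.update_self]
    ring
  let e : (ι → Ω) × Ω ≃ (ι → Ω) × Ω :=
    { toFun := fun q => (Function.update q.1 j q.2, q.1 j)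
      invFun := fun q => (Function.update q.1 j q.2, q.1 j)
      left_inv := fun q => by simp
      right_inv := fun q => by simp }
  have h1 : (expect (prodWeight w) fun X => expect w fun x => f (Function.update X j x)) =
      ∑ q : (ι → Ω) × Ω, prodWeight w (e q).1 * w (e q).2 * f (e q).1 := by
    rw [Fintype.sum_prod_type]
    simp only [expect, mul_sum]
    refine sum_congr rfl fun X _ => sum_congr rfl fun x _ => ?_
    rw [← mul_assoc, key]
    rfl
  rw [h1, e.sum_comp (fun q : (ι → Ω) × Ω => prodWeight w q.1 * w q.2 * f q.1),
    Fintype.sum_prod_type]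
  refine sum_congr rfl fun X _ => ?_
  simp only [← sum_mul, ← mul_sum, hw.sum_eq_one, mul_one]

lemma expect_transpose {κ : Type*} [Fintype κ] [DecidableEq ι] [DecidableEq κ]
    (f : (ι → κ → Ω) → ℝ) :
    expect (prodWeight (prodWeight w)) f =
      expect (prodWeight (prodWeight w)) fun C : κ → ι → Ω => f fun i j => C j i := by
  unfold expect
  rw [← (Equiv.piComm fun (_ : κ) (_ : ι) => Ω).sum_comp]
  refine sum_congr rfl fun C _ => ?_
  congr 1
  exact prod_comm

lemma expect_prod_mul [DecidableEq ι] (hw : IsWeight w) (J : Finset ι) (g : Ω → ℝ)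
    (f : (ι → Ω) → ℝ) (hf : ∀ j ∈ J, ∀ X x, f (Function.update X j x) = f X) :
    expect (prodWeight w) (fun X => (∏ j ∈ J, g (X j)) * f X) =
      expect w g ^ #J * expect (prodWeight w) f := by
  induction J using Finset.induction_on with
  | empty => simp
  | insert a s ha ih =>
    rw [expect_resample hw a, card_insert_of_notMem ha, pow_succ', mul_assoc,
      ← ih fun j hj => hf j (mem_insert_of_mem hj), ← expect_mul_left]
    congr 1
    ext X
    rw [← expect_mul_right]
    congr 1
    ext x
    rw [prod_insert ha, hf a (mem_insert_self a s), Function.update_self, mul_assoc]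
    congr 2
    refine prod_congr rfl fun i hi => ?_
    rw [Function.update_of_ne (ne_of_mem_of_not_mem hi ha)]

open Classical in
/-- The push-forward of a weight. -/
noncomputable def mapWeight (φ : Ω → Ω') (w : Ω → ℝ) (a : Ω') : ℝ := ∑ x with φ x = a, w x

lemma expect_mapWeight (φ : Ω → Ω') (F : Ω' → ℝ) :
    expect (mapWeight φ w) F = expect w fun x => F (φ x) := by
  classical
  unfold expect mapWeight
  rw [← sum_fiberwise (s := univ) (g := φ)]
  refine sum_congr rfl fun a _ => ?_
  rw [sum_mul]
  refine sum_congr (by ext; simp) fun x hx => ?_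
  simp only [(mem_filter.1 hx).2]

omit [Fintype Ω'] in
lemma prodWeight_mapWeight [DecidableEq ι] (φ : Ω → Ω') :
    (prodWeight (mapWeight φ w) : (ι → Ω') → ℝ) =
      mapWeight (fun (x : ι → Ω) i => φ (x i)) (prodWeight w) := by
  classical
  ext a
  unfold prodWeight mapWeight
  rw [Finset.prod_univ_sum]
  refine sum_congr ?_ fun _ _ => rfl
  ext x
  simp [Fintype.mem_piFinset, funext_iff]

end Expectation

end DetDivisors

namespace DetDivisors

open Finset Module

section Odlyzko

variable {F : Type*} [Field F] [Fintype F] {w : F → ℝ} {q : ℝ}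

lemma prob_mem_submodule_le (hw : IsWeight w) (hq0 : 0 ≤ q) (hq1 : q ≤ 1) (hq : ∀ a, w a ≤ q) :
    ∀ {m : ℕ} (U : Submodule F (Fin m → F)),
      prob (prodWeight w) (· ∈ U) ≤ q ^ (m - finrank F U) := by
  classical
  intro m
  induction m with
  | zero =>
    intro U
    simpa using prob_le_one hw.prodWeight _
  | succ m ih =>
    intro U
    let tail : (Fin (m + 1) → F) →ₗ[F] (Fin m → F) := LinearMap.funLeft F F Fin.succ
    have htail : ∀ (x : F) (y : Fin m → F), tail (Fin.cons x y) = y := by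
      intro x y
      ext i
      simp [tail, LinearMap.funLeft]
    have hdim : finrank F (U.map tail) + finrank F (LinearMap.ker (tail.domRestrict U)) =
        finrank F U := by
      rw [← LinearMap.range_domRestrict]
      exact LinearMap.finrank_range_add_finrank_ker _
    have hle : finrank F (U.map tail) ≤ m := (Submodule.finrank_le _).trans (by simp)
    have hcons : prob (prodWeight w) (· ∈ U) =
        expect (prodWeight w) fun y : Fin m → F => expect w fun x => ind (Fin.cons x y ∈ U) := by
      unfold prob
      rw [expect_cons, expect_comm]
    have hstep : ∀ c : ℝ, 0 ≤ c →
        (∀ y : Fin m → F, expect w (fun x => ind ((Fin.cons x y : Fin (m + 1) → F) ∈ U)) ≤ c) →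
        prob (prodWeight w) (· ∈ U) ≤ c * q ^ (m - finrank F (U.map tail)) := by
      intro c hc h
      rw [hcons]
      refine le_trans ?_ (mul_le_mul_of_nonneg_left (ih (U.map tail)) hc)
      unfold prob
      rw [← expect_mul_left]
      refine expect_mono hw.prodWeight fun y => ?_
      by_cases hy : y ∈ U.map tail
      · rw [ind_of_true hy, mul_one]
        exact h y
      · rw [ind_of_false hy, mul_zero]
        refine le_of_eq ?_
        rw [← expect_const hw 0]
        congr 1
        ext x
        exact ind_of_false fun hx => hy ⟨_, hx, htail x y⟩
    by_cases hker : ∀ x : F, (Fin.cons x 0 : Fin (m + 1) → F) ∈ U → x = 0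
    · refine (hstep q hq0 fun y => ?_).trans ?_
      · by_cases hy : ∃ x : F, (Fin.cons x y : Fin (m + 1) → F) ∈ U
        · obtain ⟨x₀, hx₀⟩ := hy
          refine le_trans ?_ (hq x₀)
          unfold expect
          rw [sum_eq_single x₀]
          · exact mul_le_of_le_one_right (hw.nonneg _) (ind_le_one _)
          · intro x _ hx
            refine mul_eq_zero_of_right _ (ind_of_false fun hxU => ?_)
            refine hx (sub_eq_zero.1 (hker _ ?_))
            convert U.sub_mem hxU hx₀ using 1
            ext i
            refine Fin.cases ?_ (fun i => ?_) i <;> simp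
          · simp
        · push Not at hy
          refine le_trans (le_of_eq ?_) hq0
          rw [← expect_const hw 0]
          congr 1
          ext x
          exact ind_of_false (hy x)
      · rw [← pow_succ']
        exact pow_le_pow_of_le_one hq0 hq1 (by omega)
    · push Not at hker
      obtain ⟨x, hxU, hx⟩ := hker
      refine (hstep 1 zero_le_one fun y => ?_).trans ?_
      · exact (expect_mono hw fun _ => ind_le_one _).trans_eq (expect_const hw 1)
      · have hpos : 0 < finrank F (LinearMap.ker (tail.domRestrict U)) := by
          refine Submodule.one_le_finrank_iff.2 ((Submodule.ne_bot_iff _).2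
            ⟨⟨Fin.cons x 0, hxU⟩, ?_, fun h => hx ?_⟩)
          · rw [LinearMap.mem_ker, LinearMap.domRestrict_apply]
            exact htail x 0
          · have := congrArg (fun u => (u.1 : Fin (m + 1) → F) 0) h
            simpa using this
        rw [one_mul]
        exact pow_le_pow_of_le_one hq0 hq1 (by omega)

lemma prob_mem_submodule_le_of_finrank_le (hw : IsWeight w) (hq0 : 0 ≤ q) (hq1 : q ≤ 1)
    (hq : ∀ a, w a ≤ q) {m d : ℕ} (U : Submodule F (Fin m → F)) (hd : finrank F U ≤ d) :
    prob (prodWeight w) (· ∈ U) ≤ q ^ (m - d) :=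
  (prob_mem_submodule_le hw hq0 hq1 hq U).trans (pow_le_pow_of_le_one hq0 hq1 (by omega))

lemma pow_le_prob_linearIndependent (hw : IsWeight w) (hq0 : 0 ≤ q) (hq1 : q ≤ 1)
    (hq : ∀ a, w a ≤ q) {n : ℕ} (V : Submodule F (Fin n → F)) (r : ℕ)
    (hr : q ^ (n - r) ≤ prob (prodWeight w) (· ∈ V) / 2) :
    (prob (prodWeight w) (· ∈ V) / 2) ^ r ≤
      prob (prodWeight (prodWeight w)) fun Y : Fin r → Fin n → F =>
        LinearIndependent F Y ∧ ∀ i, Y i ∈ V := by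
  classical
  set P := prob (prodWeight w) (· ∈ V) with hP
  have hP0 : 0 ≤ P := prob_nonneg hw.prodWeight _
  induction r with
  | zero =>
    rw [pow_zero, ← expect_const (w := prodWeight (prodWeight w))
      (hw.prodWeight.prodWeight (ι := Fin 0) (Ω := Fin n → F)) 1]
    refine expect_mono hw.prodWeight.prodWeight fun Y => ?_
    rw [ind_of_true]
    exact ⟨linearIndependent_empty_type, fun i => i.elim0⟩
  | succ r ih =>
    have hr' : q ^ (n - r) ≤ P / 2 := (pow_le_pow_of_le_one hq0 hq1 (by omega)).trans hr
    refine le_trans (b := P / 2 * prob (prodWeight (prodWeight w)) fun Y : Fin r → Fin n → F =>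
        LinearIndependent F Y ∧ ∀ i, Y i ∈ V) ?_ ?_
    · rw [pow_succ']
      exact mul_le_mul_of_nonneg_left (ih hr') (by positivity)
    · unfold prob
      rw [expect_cons, expect_comm, ← expect_mul_left]
      refine expect_mono hw.prodWeight.prodWeight fun Y => ?_
      by_cases hY : LinearIndependent F Y ∧ ∀ i, Y i ∈ V
      · rw [ind_of_true hY, mul_one]
        have h1 : prob (prodWeight w) (· ∈ Submodule.span F (Set.range Y)) ≤ q ^ (n - r) :=
          prob_mem_submodule_le_of_finrank_le hw hq0 hq1 hq _
            ((finrank_range_le_card Y).trans (by simp))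
        have h2 : P ≤ prob (prodWeight w) (· ∈ Submodule.span F (Set.range Y)) +
            expect (prodWeight w) fun y : Fin n → F =>
              ind (LinearIndependent F (Fin.cons y Y : Fin (r + 1) → Fin n → F) ∧
                ∀ i, (Fin.cons y Y : Fin (r + 1) → Fin n → F) i ∈ V) := by
          refine le_trans ?_ (prob_or_le hw.prodWeight _ _)
          refine prob_mono hw.prodWeight fun y hy => ?_
          by_cases hs : y ∈ Submodule.span F (Set.range Y)
          · exact Or.inl hs
          · refine Or.inr ⟨linearIndependent_finCons.2 ⟨hY.1, hs⟩, fun i => ?_⟩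
            refine Fin.cases ?_ (fun i => ?_) i
            · simpa using hy
            · simpa using hY.2 i
        linarith
      · rw [ind_of_false hY, mul_zero]
        exact expect_nonneg hw.prodWeight fun _ => ind_nonneg _

end Odlyzko

end DetDivisors

namespace DetDivisors

open Finset Module

section Exchange

variable {K E ι : Type*} [Field K] [AddCommGroup E] [Module K E]

lemma finrank_span_image_of_linearIndepOn {X : ι → E} {S : Finset ι}
    (hX : LinearIndepOn K X (S : Set ι)) : finrank K (Submodule.span K (X '' S)) = #S := by
  have h := finrank_span_eq_card (b := fun i : S => X i) hX
  rw [Fintype.card_coe] at h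
  rw [← h, Set.image_eq_range]
  rfl

lemma exists_exchange [DecidableEq ι] {r : ℕ} {X : ι → E} {S : Finset ι}
    (hX : LinearIndepOn K X (S : Set ι)) {Y : Fin r → E} (hY : LinearIndependent K Y)
    (hYX : ∀ i, Y i ∈ Submodule.span K (X '' S)) :
    ∃ J ∈ S.powersetCard r,
      Submodule.span K (Set.range Y ∪ X '' (S \ J : Finset ι)) = Submodule.span K (X '' S) := by
  classical
  let v : Fin r ⊕ ι → E := Sum.elim Y X
  let s : Set (Fin r ⊕ ι) := Set.range Sum.inl
  let t : Set (Fin r ⊕ ι) := Set.range Sum.inl ∪ Sum.inr '' (S : Set ι)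
  have hs : LinearIndepOn K v s := by
    rw [linearIndepOn_range_iff Sum.inl_injective]
    exact hY
  obtain ⟨b, hbt, hsb, htb, hb⟩ := exists_linearIndepOn_extension hs
    (Set.subset_union_left : s ⊆ t)
  let J := S.filter fun j => Sum.inr j ∉ b
  have hbJ : b = ((univ : Finset (Fin r)).disjSum (S \ J) : Finset (Fin r ⊕ ι)) := by
    ext x
    rcases x with i | j
    · simpa using hsb ⟨i, rfl⟩
    · have : Sum.inr j ∈ b → j ∈ S := fun h => by simpa [t, s] using hbt h
      simp only [mem_coe, inr_mem_disjSum, mem_sdiff, J, mem_filter]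
      tauto
  have himage : v '' b = Set.range Y ∪ X '' (S \ J : Finset ι) := by
    rw [hbJ]
    ext x
    simp [v]
  have hspan : Submodule.span K (v '' b) = Submodule.span K (X '' S) := by
    refine le_antisymm (Submodule.span_le.2 ?_) (Submodule.span_le.2 ?_)
    · rw [himage]
      rintro x (⟨i, rfl⟩ | ⟨j, hj, rfl⟩)
      · exact hYX i
      · exact Submodule.subset_span ⟨j, (mem_sdiff.1 hj).1, rfl⟩
    · rintro x ⟨j, hj, rfl⟩
      exact htb ⟨Sum.inr j, Or.inr ⟨j, hj, rfl⟩, rfl⟩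
  refine ⟨J, mem_powersetCard.2 ⟨filter_subset _ _, ?_⟩, by rw [← himage, hspan]⟩
  have h1 := finrank_span_image_of_linearIndepOn hX
  have hJS : J ⊆ S := filter_subset _ _
  rw [← hspan, hbJ, finrank_span_image_of_linearIndepOn (hbJ ▸ hb), card_disjSum, card_univ,
    Fintype.card_fin, card_sdiff_of_subset hJS] at h1
  have := card_le_card hJS
  omega

end Exchange

section Swapping

variable {F : Type*} [Field F] [Fintype F] {w v : F → ℝ} {q η : ℝ}

lemma prob_span_comparable_le (hw : IsWeight w) (hv : IsWeight v) (hq0 : 0 < q) (hq1 : q ≤ 1)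
    (hq : ∀ a, v a ≤ q) (hη : 0 ≤ η) {n r : ℕ} (S : Finset (Fin n))
    (bad : Submodule F (Fin n → F) → Prop)
    (hbad : ∀ V, bad V → q ^ (n - r) ≤ prob (prodWeight v) (· ∈ V) / 2 ∧
      prob (prodWeight w) (· ∈ V) ≤ η * prob (prodWeight v) (· ∈ V)) :
    prob (prodWeight (prodWeight w)) (fun X : Fin n → Fin n → F =>
      LinearIndepOn F X (S : Set (Fin n)) ∧ bad (Submodule.span F (X '' S))) ≤
        (2 * η) ^ r * 2 ^ #S := by
  classical
  have : Finite (Submodule F (Fin n → F)) :=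
    Finite.of_injective _ (SetLike.coe_injective (A := Submodule F (Fin n → F)))
  have : Fintype (Submodule F (Fin n → F)) := Fintype.ofFinite _
  have hW : IsWeight (prodWeight (prodWeight w) : (Fin n → Fin n → F) → ℝ) :=
    hw.prodWeight.prodWeight
  have hV : IsWeight (prodWeight (prodWeight v) : (Fin r → Fin n → F) → ℝ) :=
    hv.prodWeight.prodWeight
  let Q (J : Finset (Fin n)) (V : Submodule F (Fin n → F)) : ℝ :=
    expect (prodWeight (prodWeight v)) fun Y : Fin r → Fin n → F =>
      expect (prodWeight (prodWeight w)) fun X : Fin n → Fin n → F =>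
        ind (Submodule.span F (Set.range Y ∪ X '' (S \ J : Finset (Fin n))) = V)
  have hQ0 : ∀ J V, 0 ≤ Q J V := fun J V =>
    expect_nonneg hV fun _ => expect_nonneg hW fun _ => ind_nonneg _
  have hQsum : ∀ J, ∑ V, Q J V ≤ 1 := by
    intro J
    rw [← expect_sum, ← expect_const hV 1]
    refine expect_mono hV fun Y => ?_
    rw [← expect_sum, ← expect_const hW 1]
    refine expect_mono hW fun X => ?_
    simp [ind]
  have hone : ∀ V, bad V →
      prob (prodWeight (prodWeight w)) (fun X : Fin n → Fin n → F =>
        LinearIndepOn F X (S : Set (Fin n)) ∧ Submodule.span F (X '' S) = V) ≤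
      (2 * η) ^ r * ∑ J ∈ S.powersetCard r, Q J V := by
    intro V hVbad
    obtain ⟨h1, h2⟩ := hbad V hVbad
    set Pv := prob (prodWeight v) (· ∈ V)
    set Pw := prob (prodWeight w) (· ∈ V)
    have hPw : 0 ≤ Pw := prob_nonneg hw.prodWeight _
    have hPv : 0 < Pv := by
      have := pow_pos hq0 (n - r)
      linarith
    have h3 := pow_le_prob_linearIndependent hv hq0.le hq1 hq V r h1
    set A := prob (prodWeight (prodWeight w)) (fun X : Fin n → Fin n → F =>
        LinearIndepOn F X (S : Set (Fin n)) ∧ Submodule.span F (X '' S) = V)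
    have hA : 0 ≤ A := prob_nonneg hW _
    have key : (prob (prodWeight (prodWeight v)) fun Y : Fin r → Fin n → F =>
        LinearIndependent F Y ∧ ∀ i, Y i ∈ V) * A ≤
          ∑ J ∈ S.powersetCard r, Pw ^ r * Q J V := by
      have hJ : ∀ J ∈ S.powersetCard r, Pw ^ r * Q J V =
          expect (prodWeight (prodWeight v)) fun Y : Fin r → Fin n → F =>
            expect (prodWeight (prodWeight w)) fun X : Fin n → Fin n → F =>
              (∏ j ∈ J, ind (X j ∈ V)) *
              ind (Submodule.span F (Set.range Y ∪ X '' (S \ J : Finset (Fin n))) = V) := by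
        intro J hJ
        rw [← expect_mul_left]
        congr 1
        ext Y
        rw [expect_prod_mul hw.prodWeight J (fun x => ind (x ∈ V)), (mem_powersetCard.1 hJ).2]
        · rfl
        · intro j hj X x
          have : Function.update X j x '' (S \ J : Finset (Fin n)) =
              X '' (S \ J : Finset (Fin n)) := by
            refine Set.image_congr fun i hi => ?_
            rw [Function.update_of_ne]
            rintro rfl
            exact (mem_sdiff.1 hi).2 hj
          rw [this]
      rw [sum_congr rfl hJ, ← expect_sum]
      unfold A prob
      rw [← expect_mul_right]
      refine expect_mono hV fun Y => ?_
      rw [← expect_sum, ← expect_mul_left]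
      refine expect_mono hW fun X => ?_
      rw [← ind_and]
      refine le_trans (ind_mono ?_) ((ind_exists_le (S.powersetCard r) fun J =>
        (∀ j ∈ J, X j ∈ V) ∧
          Submodule.span F (Set.range Y ∪ X '' (S \ J : Finset (Fin n))) = V).trans_eq ?_)
      · rintro ⟨⟨hY, hYV⟩, hX, rfl⟩
        obtain ⟨J, hJ, hspan⟩ := exists_exchange hX hY hYV
        exact ⟨J, hJ, fun j hj => Submodule.subset_span
          ⟨j, (mem_powersetCard.1 hJ).1 hj, rfl⟩, hspan⟩
      · refine sum_congr rfl fun J _ => ?_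
        rw [ind_and, prod_ind]
    rw [← mul_sum] at key
    have h4 : (Pv / 2) ^ r * A ≤ (η * Pv) ^ r * ∑ J ∈ S.powersetCard r, Q J V := by
      calc (Pv / 2) ^ r * A ≤ _ := mul_le_mul_of_nonneg_right h3 hA
        _ ≤ _ := key
        _ ≤ _ := by
          refine mul_le_mul_of_nonneg_right (pow_le_pow_left₀ hPw h2 r)
            (sum_nonneg fun J _ => hQ0 J V)
    have h5 : (η * Pv) ^ r = (Pv / 2) ^ r * (2 * η) ^ r := by
      rw [← mul_pow]
      congr 1
      ring
    rw [h5, mul_assoc] at h4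
    exact le_of_mul_le_mul_left h4 (by positivity)
  calc _ ≤ prob (prodWeight (prodWeight w)) (fun X : Fin n → Fin n → F =>
        ∃ V ∈ univ.filter bad, LinearIndepOn F X (S : Set (Fin n)) ∧
          Submodule.span F (X '' S) = V) :=
        prob_mono hW fun X hX => ⟨_, by simpa using hX.2, hX.1, rfl⟩
    _ ≤ _ := prob_exists_le hW _ _
    _ ≤ ∑ V ∈ univ.filter bad, (2 * η) ^ r * ∑ J ∈ S.powersetCard r, Q J V :=
        sum_le_sum fun V hV => hone V (mem_filter.1 hV).2
    _ ≤ ∑ V, (2 * η) ^ r * ∑ J ∈ S.powersetCard r, Q J V :=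
        sum_le_sum_of_subset_of_nonneg (filter_subset _ _) fun V _ _ =>
          mul_nonneg (by positivity) (sum_nonneg fun J _ => hQ0 J V)
    _ = (2 * η) ^ r * ∑ J ∈ S.powersetCard r, ∑ V, Q J V := by
        rw [← mul_sum, sum_comm]
    _ ≤ (2 * η) ^ r * ∑ J ∈ S.powersetCard r, 1 := by
        gcongr with J
        exact hQsum J
    _ ≤ _ := by
        gcongr
        rw [sum_const, nsmul_eq_mul, mul_one, card_powersetCard]
        exact_mod_cast Nat.choose_le_two_pow _ _

end Swapping

end DetDivisors

namespace DetDivisors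

open Finset

section LayerCake


lemma ofReal_eq_lintegral_levels {x : ℝ} :
    ENNReal.ofReal x = ∫⁻ t in Set.Ioi (0 : ℝ), (Set.Iic x).indicator 1 t := by
  rw [lintegral_indicator_one measurableSet_Iic, Measure.restrict_apply measurableSet_Iic,
    Set.inter_comm, Set.Ioi_inter_Iic, Real.volume_Ioc, sub_zero]

lemma mul_sum_le_sum_of_levels {α : Type*} (s : Finset α) (u v : α → ℝ) (c : ℕ)
    (hu : ∀ a ∈ s, 0 ≤ u a) (hv : ∀ a ∈ s, 0 ≤ v a)
    (h : ∀ t : ℝ, 0 < t → c * #{a ∈ s | t ≤ u a} ≤ #{a ∈ s | t ≤ v a}) :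
    c * ∑ a ∈ s, u a ≤ ∑ a ∈ s, v a := by
  have key : ∀ f : α → ℝ, (∀ a ∈ s, 0 ≤ f a) → ENNReal.ofReal (∑ a ∈ s, f a) =
      ∫⁻ t in Set.Ioi (0 : ℝ), (#{a ∈ s | t ≤ f a} : ENNReal) := by
    intro f hf
    rw [ENNReal.ofReal_sum_of_nonneg hf, sum_congr rfl fun a _ => ofReal_eq_lintegral_levels,
      ← lintegral_finsetSum s fun a _ => measurable_one.indicator measurableSet_Iic]
    congr 1
    ext t
    simp [Set.indicator_apply, sum_boole]
  rw [← ENNReal.ofReal_le_ofReal_iff (sum_nonneg hv), ENNReal.ofReal_mul (by positivity),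
    key u hu, key v hv, ENNReal.ofReal_natCast,
    ← lintegral_const_mul' _ _ (ENNReal.natCast_ne_top c)]
  refine setLIntegral_mono' measurableSet_Ioi fun t ht => ?_
  exact_mod_cast h t ht

end LayerCake

section Sumset

open scoped Pointwise

variable {p : ℕ} [Fact p.Prime] {S : ZMod p → ℝ}

lemma two_mul_card_level_le (h0 : S 0 = 0) (hadd : ∀ t u, S (t + u) ≤ 2 * (S t + S u)) {T : ℝ}
    (hT : ∃ t, 4 * T < S t) :
    2 * #{t | t ≠ 0 ∧ S t ≤ T} ≤ #{t | t ≠ 0 ∧ S t ≤ 4 * T} := by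
  rcases lt_or_ge T 0 with hneg | hpos
  · have hS : ∀ t, 0 ≤ S t := fun t => by
      have h1 := hadd t 0
      rw [add_zero, h0] at h1
      linarith
    rw [filter_false_of_mem fun t _ h => by linarith [hS t, h.2]]
    simp
  · have herase : ∀ R : ℝ, 0 ≤ R →
        #{t | t ≠ 0 ∧ S t ≤ R} + 1 = #{t : ZMod p | S t ≤ R} := by
      intro R hR
      rw [← card_erase_add_one (s := {t : ZMod p | S t ≤ R}) (a := 0) (by simp [h0, hR])]
      congr 2
      ext t
      simp
    have hne : ({t : ZMod p | S t ≤ T} : Finset (ZMod p)).Nonempty := ⟨0, by simp [h0, hpos]⟩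
    have hcd := ZMod.cauchy_davenport Fact.out hne hne
    have hsub : ({t : ZMod p | S t ≤ T} : Finset (ZMod p)) +
        ({t : ZMod p | S t ≤ T} : Finset (ZMod p)) ⊆
        ({t : ZMod p | S t ≤ 4 * T} : Finset (ZMod p)) := by
      intro x hx
      obtain ⟨a, ha, b, hb, rfl⟩ := mem_add.1 hx
      simp only [mem_filter, mem_univ, true_and] at ha hb ⊢
      linarith [hadd a b]
    have hlt : #({t : ZMod p | S t ≤ 4 * T} : Finset (ZMod p)) < p := by
      obtain ⟨t, ht⟩ := hT
      conv_rhs => rw [← ZMod.card p]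
      exact card_lt_univ_of_notMem (x := t) (by simpa using ht)
    have hle := card_le_card hsub
    have h1 := herase T hpos
    have h2 := herase (4 * T) (by positivity)
    rcases le_total p (#{t : ZMod p | S t ≤ T} + #{t : ZMod p | S t ≤ T} - 1) with h | h
    · rw [min_eq_left h] at hcd
      omega
    · rw [min_eq_right h] at hcd
      omega

lemma two_pow_mul_card_level_le (h0 : S 0 = 0) (hadd : ∀ t u, S (t + u) ≤ 2 * (S t + S u))
    {T₁ : ℝ} (hT₁ : ∃ t, T₁ < S t) (l : ℕ) {T : ℝ} (hT : 4 ^ l * T ≤ T₁) :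
    2 ^ l * #{t | t ≠ 0 ∧ S t ≤ T} ≤ #{t | t ≠ 0 ∧ S t ≤ 4 ^ l * T} := by
  rcases lt_or_ge T 0 with hneg | hpos
  · have hS : ∀ t, 0 ≤ S t := fun t => by
      have h1 := hadd t 0
      rw [add_zero, h0] at h1
      linarith
    rw [filter_false_of_mem fun t _ h => by linarith [hS t, h.2]]
    simp
  induction l with
  | zero => simp
  | succ l ih =>
    have hl : 4 ^ l * T ≤ 4 ^ (l + 1) * T := by
      rw [pow_succ]
      nlinarith [pow_pos (four_pos (α := ℝ)) l, mul_nonneg (pow_pos (four_pos (α := ℝ)) l).le hpos]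
    obtain ⟨t, ht⟩ := hT₁
    have h1 := ih (hl.trans hT)
    have h2 := two_mul_card_level_le h0 hadd (T := 4 ^ l * T)
      ⟨t, by rw [← mul_assoc, ← pow_succ']; linarith⟩
    rw [← mul_assoc, ← pow_succ'] at h2
    rw [pow_succ', mul_assoc]
    omega

lemma sum_exp_neg_le (h0 : S 0 = 0) (hadd : ∀ t u, S (t + u) ≤ 2 * (S t + S u))
    {T₁ : ℝ} (hT₁ : ∃ t, T₁ < S t) (l : ℕ) :
    ∑ t with t ≠ 0, Real.exp (-S t) ≤
      ((2 : ℝ) ^ l)⁻¹ * ∑ t with t ≠ 0, Real.exp (-(S t / 4 ^ l)) +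
        p * Real.exp (-(T₁ / 4 ^ l)) := by
  let u : ZMod p → ℝ := fun t => if S t ≤ T₁ / 4 ^ l then Real.exp (-S t) else 0
  have hlevels : (2 ^ l : ℕ) * ∑ t with t ≠ 0, u t ≤
      ∑ t : ZMod p with t ≠ 0, Real.exp (-(S t / 4 ^ l)) := by
    refine mul_sum_le_sum_of_levels _ _ _ _ (fun t _ => ?_) (fun t _ => (Real.exp_pos _).le)
      fun x hx => ?_
    · unfold u
      split_ifs
      exacts [(Real.exp_pos _).le, le_rfl]
    · rw [filter_filter, filter_filter]
      set T := min (T₁ / 4 ^ l) (-Real.log x) with hTdef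
      have hT : 4 ^ l * T ≤ T₁ := by
        rw [mul_comm, ← le_div_iff₀ (by positivity)]
        exact min_le_left _ _
      refine le_trans (Nat.mul_le_mul_left _ (card_le_card ?_))
        ((two_pow_mul_card_level_le h0 hadd hT₁ l hT).trans (card_le_card ?_))
      · intro t
        simp only [mem_filter, mem_univ, true_and]
        rintro ⟨ht, hxt⟩
        refine ⟨ht, ?_⟩
        unfold u at hxt
        split_ifs at hxt with hS
        · refine le_min hS ?_
          have := (Real.log_le_iff_le_exp hx).2 hxt
          linarith
        · linarith
      · intro t
        simp only [mem_filter, mem_univ, true_and]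
        rintro ⟨ht, hS⟩
        refine ⟨ht, (Real.log_le_iff_le_exp hx).1 ?_⟩
        have h1 : S t / 4 ^ l ≤ T := by
          rw [div_le_iff₀ (by positivity)]
          linarith
        have h2 : T ≤ -Real.log x := min_le_right _ _
        linarith
  have hu : ∀ t, Real.exp (-S t) ≤ u t + Real.exp (-(T₁ / 4 ^ l)) := by
    intro t
    unfold u
    split_ifs with h
    · linarith [Real.exp_pos (-(T₁ / 4 ^ l))]
    · rw [zero_add]
      exact Real.exp_le_exp.2 (by linarith)
  calc ∑ t with t ≠ 0, Real.exp (-S t)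
      ≤ ∑ t : ZMod p with t ≠ 0, (u t + Real.exp (-(T₁ / 4 ^ l))) := sum_le_sum fun t _ => hu t
    _ = ∑ t : ZMod p with t ≠ 0, u t +
          #{t : ZMod p | t ≠ 0} * Real.exp (-(T₁ / 4 ^ l)) := by
        rw [sum_add_distrib, sum_const, nsmul_eq_mul]
    _ ≤ _ := by
        refine add_le_add ?_ (mul_le_mul_of_nonneg_right ?_ (Real.exp_pos _).le)
        · rw [inv_mul_eq_div, le_div_iff₀ (by positivity), mul_comm]
          exact_mod_cast hlevels
        · have := card_le_univ ({t : ZMod p | t ≠ 0} : Finset (ZMod p))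
          rw [ZMod.card] at this
          exact_mod_cast this

end Sumset

end DetDivisors

namespace DetDivisors

open Finset Module

variable {p : ℕ} [Fact p.Prime]

/-- For `t` in `ZMod p`, the quantity `sin² (π t / p)`. -/
noncomputable def sinSq (t : ZMod p) : ℝ := ‖1 - ZMod.stdAddChar t‖ ^ 2 / 4

lemma norm_stdAddChar (t : ZMod p) : ‖ZMod.stdAddChar t‖ = 1 := by
  rw [ZMod.stdAddChar_apply, Circle.norm_coe]

lemma sinSq_nonneg (t : ZMod p) : 0 ≤ sinSq t := by unfold sinSq; positivity

lemma sinSq_zero : sinSq (0 : ZMod p) = 0 := by simp [sinSq]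

lemma sinSq_eq (t : ZMod p) : sinSq t = (1 - (ZMod.stdAddChar t).re) / 2 := by
  have h := norm_stdAddChar t
  rw [← sq_eq_sq₀ (norm_nonneg _) zero_le_one, Complex.sq_norm, Complex.normSq_apply] at h
  rw [sinSq, Complex.sq_norm, Complex.normSq_apply]
  simp only [Complex.sub_re, Complex.one_re, Complex.sub_im, Complex.one_im]
  linarith

lemma sinSq_le_one (t : ZMod p) : sinSq t ≤ 1 := by
  have h := Complex.abs_re_le_norm (ZMod.stdAddChar t)
  rw [norm_stdAddChar, abs_le] at h
  rw [sinSq_eq]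
  linarith

lemma sinSq_add_le (t u : ZMod p) : sinSq (t + u) ≤ 2 * (sinSq t + sinSq u) := by
  have h : ‖1 - ZMod.stdAddChar (t + u)‖ ≤
      ‖1 - ZMod.stdAddChar t‖ + ‖1 - ZMod.stdAddChar u‖ := by
    have h1 : 1 - ZMod.stdAddChar (t + u) = (1 - ZMod.stdAddChar t) +
        ZMod.stdAddChar t * (1 - ZMod.stdAddChar u) := by
      rw [AddChar.map_add_eq_mul]
      ring
    rw [h1]
    refine (norm_add_le _ _).trans_eq ?_
    rw [norm_mul, norm_stdAddChar, one_mul]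
  unfold sinSq
  have h2 := pow_le_pow_left₀ (norm_nonneg _) h 2
  nlinarith [sq_nonneg (‖1 - ZMod.stdAddChar t‖ - ‖1 - ZMod.stdAddChar u‖)]

lemma sum_sinSq_mul {a : ZMod p} (ha : a ≠ 0) : ∑ t : ZMod p, sinSq (t * a) = p / 2 := by
  have h0 : ∑ t : ZMod p, ZMod.stdAddChar (t * a) = 0 := by
    rw [AddChar.sum_mulShift a (ZMod.isPrimitive_stdAddChar p)]
    simp [ha]
  have h1 := congrArg Complex.re h0
  rw [Complex.re_sum, Complex.zero_re] at h1
  simp_rw [sinSq_eq]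
  rw [← sum_div, sum_sub_distrib, h1]
  simp

/-- The law on `ZMod p` giving mass `ν` to each of `1` and `-1` and the remaining mass to `0`. -/
noncomputable def entryWeight (p : ℕ) (ν : ℝ) (a : ZMod p) : ℝ :=
  (1 - 2 * ν) * (if a = 0 then 1 else 0) + ν * (if a = 1 then 1 else 0) +
    ν * (if a = -1 then 1 else 0)

lemma isWeight_entryWeight {ν : ℝ} (h0 : 0 ≤ ν) (h1 : ν ≤ 1 / 4) :
    IsWeight (entryWeight p ν) where
  nonneg a := by
    unfold entryWeight
    have : 0 ≤ 1 - 2 * ν := by linarith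
    positivity
  sum_eq_one := by
    simp only [entryWeight, sum_add_distrib, ← mul_sum, sum_ite_eq', mem_univ, if_true]
    ring

lemma entryWeight_le {ν : ℝ} (h1 : ν ≤ 1 / 4) (a : ZMod p) :
    entryWeight p ν a ≤ 1 - 2 * ν := by
  unfold entryWeight
  by_cases ha : a = 0
  · subst ha
    simp
  · rw [if_neg ha]
    split_ifs <;> linarith

lemma sum_entryWeight_mul (ν : ℝ) (t : ZMod p) :
    ∑ a, (entryWeight p ν a : ℂ) * ZMod.stdAddChar (t * a) = ((1 - 4 * ν * sinSq t : ℝ) : ℂ) := by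
  have h1 : ∀ a : ZMod p, (entryWeight p ν a : ℂ) * ZMod.stdAddChar (t * a) =
      (if a = 0 then (1 - 2 * ν : ℂ) * ZMod.stdAddChar (t * a) else 0) +
      (if a = 1 then (ν : ℂ) * ZMod.stdAddChar (t * a) else 0) +
      (if a = -1 then (ν : ℂ) * ZMod.stdAddChar (t * a) else 0) := by
    intro a
    unfold entryWeight
    push_cast
    split_ifs <;> simp <;> ring
  rw [sum_congr rfl fun a _ => h1 a]
  simp only [sum_add_distrib, sum_ite_eq', mem_univ, if_true, mul_zero, mul_one, mul_neg,
    AddChar.map_zero_eq_one]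
  have h2 : ZMod.stdAddChar t + ZMod.stdAddChar (-t) =
      ((2 * (ZMod.stdAddChar t).re : ℝ) : ℂ) := by
    have : ZMod.stdAddChar (-t) = (starRingEnd ℂ) (ZMod.stdAddChar t) := by
      rw [AddChar.map_neg_eq_inv, Complex.inv_eq_conj (norm_stdAddChar t)]
    rw [this, Complex.add_conj]
  rw [add_assoc, ← mul_add, h2, sinSq_eq]
  push_cast
  ring

/-- The characteristic function of a vector with i.i.d. entries of law `entryWeight p ν`. -/
noncomputable def charFn {n : ℕ} (ν : ℝ) (w : Fin n → ZMod p) : ℝ :=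
  ∏ i, (1 - 4 * ν * sinSq (w i))

/-- The orthogonal complement of a subspace for the dot product. -/
noncomputable def orth {n : ℕ} (V : Submodule (ZMod p) (Fin n → ZMod p)) :
    Submodule (ZMod p) (Fin n → ZMod p) :=
  V.dualAnnihilator.map (dotProductEquiv (ZMod p) (Fin n)).symm.toLinearMap

variable {n : ℕ} {V : Submodule (ZMod p) (Fin n → ZMod p)}

lemma mem_orth {w : Fin n → ZMod p} : w ∈ orth V ↔ ∀ x ∈ V, w ⬝ᵥ x = 0 := by
  unfold orth
  rw [Submodule.mem_map_equiv, Submodule.mem_dualAnnihilator]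
  rfl

lemma natCard_orth (V : Submodule (ZMod p) (Fin n → ZMod p)) :
    Nat.card (orth V) = p ^ (n - finrank (ZMod p) V) := by
  have h1 := Subspace.finrank_add_finrank_dualAnnihilator_eq V
  have h2 : finrank (ZMod p) (orth V) = finrank (ZMod p) V.dualAnnihilator :=
    LinearEquiv.finrank_map_eq _ _
  rw [finrank_fin_fun] at h1
  rw [Module.natCard_eq_pow_finrank (K := ZMod p), Nat.card_zmod, h2]
  congr 1
  omega

lemma exists_mem_orth_dotProduct_ne_zero {x : Fin n → ZMod p} (hx : x ∉ V) :
    ∃ w ∈ orth V, w ⬝ᵥ x ≠ 0 := by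
  obtain ⟨f, hfx, hf⟩ := Submodule.exists_le_ker_of_notMem hx
  refine ⟨(dotProductEquiv (ZMod p) (Fin n)).symm f, ?_, ?_⟩
  · exact Submodule.mem_map_of_mem ((Submodule.mem_dualAnnihilator f).2 fun y hy => hf hy)
  · rwa [← dotProductEquiv_apply_apply, LinearEquiv.apply_symm_apply]

open Classical in
lemma sum_orth_stdAddChar (x : Fin n → ZMod p) :
    ∑ w with w ∈ orth V, (ZMod.stdAddChar (w ⬝ᵥ x) : ℂ) =
      (p ^ (n - finrank (ZMod p) V) : ℕ) * (ind (x ∈ V) : ℂ) := by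
  by_cases hx : x ∈ V
  · rw [ind_of_true hx, ← natCard_orth, Nat.card_eq_fintype_card, Fintype.card_subtype,
      sum_congr rfl (g := fun _ => 1) fun w hw => ?_]
    · simp
    · rw [mem_orth.1 (mem_filter.1 hw).2 x hx, AddChar.map_zero_eq_one]
  · obtain ⟨w₀, hw₀, hne⟩ := exists_mem_orth_dotProduct_ne_zero hx
    rw [ind_of_false hx, Complex.ofReal_zero, mul_zero]
    have h1 : ZMod.stdAddChar (w₀ ⬝ᵥ x) *
        ∑ w with w ∈ orth V, (ZMod.stdAddChar (w ⬝ᵥ x) : ℂ) =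
          ∑ w with w ∈ orth V, (ZMod.stdAddChar (w ⬝ᵥ x) : ℂ) := by
      rw [mul_sum]
      refine sum_equiv (Equiv.addLeft w₀) (fun w => ?_) fun w _ => ?_
      · simp [Submodule.add_mem_iff_right _ hw₀]
      · simp [add_dotProduct, AddChar.map_add_eq_mul]
    by_contra h
    have h2 := mul_right_cancel₀ h (h1.trans (one_mul _).symm)
    rw [← AddChar.map_zero_eq_one (ZMod.stdAddChar (N := p))] at h2
    exact hne (ZMod.injective_stdAddChar h2)

open Classical in
lemma prob_mem_eq_sum_charFn (ν : ℝ) :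
    (p : ℝ) ^ (n - finrank (ZMod p) V) * prob (prodWeight (entryWeight p ν)) (· ∈ V) =
      ∑ w with w ∈ orth V, charFn ν w := by
  apply Complex.ofReal_injective
  have hchar : ∀ w : Fin n → ZMod p, ((charFn ν w : ℝ) : ℂ) =
      ∑ x : Fin n → ZMod p, (prodWeight (entryWeight p ν) x : ℂ) *
        ZMod.stdAddChar (w ⬝ᵥ x) := by
    intro w
    unfold charFn
    rw [Complex.ofReal_prod, prod_congr rfl fun i _ => (sum_entryWeight_mul ν (w i)).symm,
      Finset.prod_univ_sum, Fintype.piFinset_univ]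
    refine sum_congr rfl fun x _ => ?_
    rw [prod_mul_distrib, prodWeight, Complex.ofReal_prod]
    congr 1
    exact (map_prod (ZMod.stdAddChar (N := p)).toMonoidHom (fun i => Multiplicative.ofAdd (w i * x i)) univ).symm
  rw [Complex.ofReal_sum, sum_congr rfl fun w _ => hchar w, sum_comm]
  unfold prob expect
  push_cast
  rw [mul_sum]
  refine sum_congr rfl fun x _ => ?_
  rw [← mul_sum, sum_orth_stdAddChar]
  push_cast
  ring

end DetDivisors

namespace DetDivisors

open Finset Module

variable {p : ℕ} [Fact p.Prime] {n : ℕ} {V : Submodule (ZMod p) (Fin n → ZMod p)}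

lemma charFn_zero (ν : ℝ) : charFn ν (0 : Fin n → ZMod p) = 1 := by
  simp [charFn, sinSq_zero]

lemma charFn_anti {ν ν' : ℝ} (h : ν ≤ ν') (h1 : ν' ≤ 1 / 4) (w : Fin n → ZMod p) :
    charFn ν' w ≤ charFn ν w :=
  prod_le_prod (fun i _ => by nlinarith [sinSq_nonneg (w i), sinSq_le_one (w i)])
    fun i _ => by nlinarith [sinSq_nonneg (w i)]

lemma prob_mem_anti {ν ν' : ℝ} (h : ν ≤ ν') (h1 : ν' ≤ 1 / 4) :
    prob (prodWeight (entryWeight p ν')) (· ∈ V) ≤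
      prob (prodWeight (entryWeight p ν)) (· ∈ V) := by
  classical
  have hp : (0 : ℝ) < p := by exact_mod_cast (Fact.out : p.Prime).pos
  refine le_of_mul_le_mul_left ?_ (pow_pos hp (n - finrank (ZMod p) V))
  rw [prob_mem_eq_sum_charFn, prob_mem_eq_sum_charFn]
  exact sum_le_sum fun w _ => charFn_anti h h1 w

lemma charFn_quarter_le (w : Fin n → ZMod p) :
    charFn (1 / 4) w ≤ Real.exp (-∑ i, sinSq (w i)) := by
  rw [← sum_neg_distrib, Real.exp_sum]
  refine prod_le_prod (fun i _ => by linarith [sinSq_le_one (w i)]) fun i _ => ?_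
  linarith [Real.add_one_le_exp (-sinSq (w i))]

lemma exp_neg_le_one_sub_half {x : ℝ} (h0 : 0 ≤ x) (h1 : x ≤ 1) : Real.exp (-x) ≤ 1 - x / 2 := by
  rw [Real.exp_neg, inv_le_comm₀ (Real.exp_pos _) (by linarith)]
  refine le_trans ?_ (Real.add_one_le_exp x)
  rw [inv_le_iff_one_le_mul₀ (by linarith)]
  nlinarith

lemma exp_neg_le_charFn (l : ℕ) (w : Fin n → ZMod p) :
    Real.exp (-((∑ i, sinSq (w i)) / 4 ^ l)) ≤ charFn (1 / (8 * 4 ^ l)) w := by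
  rw [sum_div, ← sum_neg_distrib, Real.exp_sum]
  refine prod_le_prod (fun i _ => (Real.exp_pos _).le) fun i _ => ?_
  have h4 : (1 : ℝ) ≤ 4 ^ l := one_le_pow₀ (by norm_num)
  have hs := sinSq_nonneg (w i)
  have hs1 := sinSq_le_one (w i)
  refine (exp_neg_le_one_sub_half (by positivity) ?_).trans_eq ?_
  · rw [div_le_one (by positivity)]
    linarith
  · field_simp
    ring

lemma exists_lt_sum_sinSq {w : Fin n → ZMod p} {T : ℝ} (hT : T < #{i | w i ≠ 0} / 2) :
    ∃ t : ZMod p, T < ∑ i, sinSq (t * w i) := by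
  by_contra! h
  have hp : (0 : ℝ) < p := by exact_mod_cast (Fact.out : p.Prime).pos
  have h1 : ∑ t : ZMod p, ∑ i, sinSq (t * w i) ≤ p * T := by
    refine (sum_le_sum fun t _ => h t).trans_eq ?_
    simp
  have h2 : ∑ t : ZMod p, ∑ i, sinSq (t * w i) = p * (#{i | w i ≠ 0} / 2) := by
    rw [sum_comm, ← sum_filter_add_sum_filter_not univ fun i => w i ≠ 0,
      sum_congr rfl fun i hi => sum_sinSq_mul (mem_filter.1 hi).2,
      sum_eq_zero (s := univ.filter fun i => ¬ w i ≠ 0)]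
    · simp
      ring
    · intro i hi
      simp only [ne_eq, not_not, mem_filter, mem_univ, true_and] at hi
      simp [hi, sinSq_zero]
  rw [h2] at h1
  exact absurd (le_of_mul_le_mul_left h1 hp) (not_le.2 hT)

lemma sum_line_charFn_le {w : Fin n → ZMod p} {T : ℝ} (hT : T < #{i | w i ≠ 0} / 2) (l : ℕ) :
    ∑ t : ZMod p with t ≠ 0, charFn (1 / 4) (t • w) ≤
      ((2 : ℝ) ^ l)⁻¹ * ∑ t : ZMod p with t ≠ 0, charFn (1 / (8 * 4 ^ l)) (t • w) +
        p * Real.exp (-(T / 4 ^ l)) := by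
  have h := sum_exp_neg_le (S := fun t : ZMod p => ∑ i, sinSq (t * w i))
    (by simp [sinSq_zero]) (fun t u => ?_) (exists_lt_sum_sinSq hT) l
  · refine (sum_le_sum fun t _ => charFn_quarter_le (t • w)).trans (h.trans ?_)
    gcongr with t
    exact exp_neg_le_charFn l (t • w)
  · rw [← sum_add_distrib, mul_sum]
    exact sum_le_sum fun i _ => by rw [add_mul]; exact sinSq_add_le _ _

open Classical in
lemma sum_orth_lines (f : (Fin n → ZMod p) → ℝ) :
    ∑ w with w ∈ orth V ∧ w ≠ 0, ∑ t : ZMod p with t ≠ 0, f (t • w) =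
      (p - 1) * ∑ w with w ∈ orth V ∧ w ≠ 0, f w := by
  rw [sum_comm]
  have h : ∀ t ∈ univ.filter fun t : ZMod p => t ≠ 0,
      ∑ w with w ∈ orth V ∧ w ≠ 0, f (t • w) = ∑ w with w ∈ orth V ∧ w ≠ 0, f w := by
    intro t ht
    have ht0 : t ≠ 0 := (mem_filter.1 ht).2
    refine sum_equiv (LinearEquiv.smulOfNeZero (ZMod p) (Fin n → ZMod p) t ht0).toEquiv
      (fun w => ?_) fun w _ => rfl
    simp only [mem_filter, mem_univ, true_and, LinearEquiv.coe_toEquiv,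
      LinearEquiv.smulOfNeZero_apply]
    rw [Submodule.smul_mem_iff _ ht0, smul_ne_zero_iff_right ht0]
  rw [sum_congr rfl h, sum_const, nsmul_eq_mul]
  congr 1
  rw [filter_ne', card_erase_of_mem (mem_univ _), card_univ, ZMod.card,
    Nat.cast_sub (Fact.out : p.Prime).one_le, Nat.cast_one]

lemma prob_mem_le_add {T : ℝ} (hT : ∀ w ∈ orth V, w ≠ 0 → T < #{i | w i ≠ 0} / 2) (l : ℕ) :
    prob (prodWeight (entryWeight p (1 / 4))) (· ∈ V) ≤
      ((p : ℝ) ^ (n - finrank (ZMod p) V))⁻¹ +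
      ((2 : ℝ) ^ l)⁻¹ * prob (prodWeight (entryWeight p (1 / (8 * 4 ^ l)))) (· ∈ V) +
      2 * Real.exp (-(T / 4 ^ l)) := by
  classical
  have hp2 : (2 : ℝ) ≤ p := by exact_mod_cast (Fact.out : p.Prime).two_le
  have hl : (1 / (8 * 4 ^ l) : ℝ) ≤ 1 / 4 := by
    have h4 : (1 : ℝ) ≤ 4 ^ l := one_le_pow₀ (by norm_num)
    exact one_div_le_one_div_of_le (by norm_num) (by linarith)
  set N : ℝ := (p : ℝ) ^ (n - finrank (ZMod p) V) with hN
  set e := Real.exp (-(T / 4 ^ l)) with he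
  have hN0 : 0 < N := by positivity
  have he0 : 0 < e := Real.exp_pos _
  have hsplit : ∀ ν : ℝ, N * prob (prodWeight (entryWeight p ν)) (· ∈ V) =
      1 + ∑ w with w ∈ orth V ∧ w ≠ 0, charFn ν w := by
    intro ν
    rw [hN, prob_mem_eq_sum_charFn, ← add_sum_erase (univ.filter (· ∈ orth V)) _ (a := 0)
      (by simp), charFn_zero]
    congr 1
    refine sum_congr ?_ fun _ _ => rfl
    ext w
    simp [and_comm]
  have hcard : (#{w : Fin n → ZMod p | w ∈ orth V ∧ w ≠ 0} : ℝ) ≤ N := by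
    have h1 : #{w : Fin n → ZMod p | w ∈ orth V} = p ^ (n - finrank (ZMod p) V) := by
      rw [← natCard_orth, Nat.card_eq_fintype_card, Fintype.card_subtype]
    have h2 : #{w : Fin n → ZMod p | w ∈ orth V ∧ w ≠ 0} ≤ #{w : Fin n → ZMod p | w ∈ orth V} :=
      card_le_card fun w hw => by
        simp only [mem_filter] at hw ⊢
        exact ⟨hw.1, hw.2.1⟩
    rw [h1] at h2
    rw [hN]
    exact_mod_cast h2
  set A := ∑ w with w ∈ orth V ∧ w ≠ 0, charFn (1 / 4) w
  set B := ∑ w with w ∈ orth V ∧ w ≠ 0, charFn (1 / (8 * 4 ^ l)) w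
  have hline : (p - 1) * A ≤ ((2 : ℝ) ^ l)⁻¹ * ((p - 1) * B) + N * (p * e) := by
    rw [← sum_orth_lines, ← sum_orth_lines, mul_sum]
    refine (sum_le_sum fun w hw => sum_line_charFn_le (hT w (mem_filter.1 hw).2.1
      (mem_filter.1 hw).2.2) l).trans ?_
    rw [sum_add_distrib, sum_const, nsmul_eq_mul]
    gcongr
  have hAB : A ≤ ((2 : ℝ) ^ l)⁻¹ * B + 2 * N * e := by
    have hp1 : (0 : ℝ) < p - 1 := by linarith
    refine le_of_mul_le_mul_left (hline.trans ?_) hp1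
    nlinarith [mul_pos hN0 he0]
  have hX := hsplit (1 / 4)
  have hY := hsplit (1 / (8 * 4 ^ l))
  have hl0 : (0 : ℝ) < ((2 : ℝ) ^ l)⁻¹ := by positivity
  refine le_of_mul_le_mul_left ?_ hN0
  rw [hX, mul_add, mul_add, mul_inv_cancel₀ hN0.ne', mul_left_comm, hY]
  nlinarith

end DetDivisors

namespace DetDivisors

open Finset Module

section SparseNormal

variable {F : Type*} [Field F] {w : F → ℝ} {n : ℕ}

/-- If the first `k` rows of a matrix have a nonzero common normal vector supported on few
coordinates, then some column lies in the span of few other columns and of the last coordinate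
vectors. -/
lemma exists_column_mem_span [DecidableEq F] {X : Fin n → Fin n → F} {k s : ℕ} {u : Fin n → F}
    (hu : u ≠ 0) (hs : #{i | u i ≠ 0} ≤ s) (hX : ∀ i : Fin n, i.val < k → X i ⬝ᵥ u = 0) :
    ∃ j, ∃ S : Finset (Fin n), #S ≤ s ∧ j ∉ S ∧ (fun i => X i j) ∈
      Submodule.span F ((S.image fun j i => X i j) ∪
        (univ.filter fun i : Fin n => k ≤ i.val).image fun i => Pi.single i (1 : F) :
          Finset (Fin n → F)) := by
  classical
  obtain ⟨j, hj⟩ := Function.ne_iff.1 hu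
  simp only [Pi.zero_apply] at hj
  refine ⟨j, (univ.filter fun i => u i ≠ 0).erase j, (card_erase_le).trans hs, by simp, ?_⟩
  set U := Submodule.span F (((((univ.filter fun i => u i ≠ 0).erase j).image fun j i => X i j) ∪
        (univ.filter fun i : Fin n => k ≤ i.val).image fun i => Pi.single i (1 : F) :
          Finset (Fin n → F)) : Set (Fin n → F)) with hU
  set y : Fin n → F := fun i => X i ⬝ᵥ u with hy
  have hyU : y ∈ U := by
    rw [← univ_sum_single y]
    refine Submodule.sum_mem _ fun i _ => ?_
    by_cases hi : i.val < k
    · have : y i = 0 := hX i hi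
      simp [this]
    · have : (Pi.single i (y i) : Fin n → F) = y i • Pi.single i (1 : F) := by
        rw [← Pi.single_smul, smul_eq_mul, mul_one]
      rw [this]
      refine U.smul_mem _ (Submodule.subset_span ?_)
      simp only [coe_union, Set.mem_union, coe_image, Set.mem_image]
      exact Or.inr ⟨i, by simpa using hi, rfl⟩
  have hsum : y = ∑ l, u l • fun i => X i l := by
    ext i
    simp [hy, dotProduct, mul_comm]
  have hrest : ∑ l ∈ univ.erase j, u l • (fun i => X i l) ∈ U := by
    refine Submodule.sum_mem _ fun l hl => ?_
    by_cases hul : u l = 0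
    · simp [hul]
    · refine U.smul_mem _ (Submodule.subset_span ?_)
      simp only [coe_union, Set.mem_union, coe_image, Set.mem_image]
      exact Or.inl ⟨l, by simpa [hul] using hl, rfl⟩
  rw [← add_sum_erase _ _ (mem_univ j)] at hsum
  have h1 : u j • (fun i => X i j) ∈ U := by
    rw [eq_sub_of_add_eq hsum.symm]
    exact U.sub_mem hyU hrest
  exact (Submodule.smul_mem_iff U hj).1 h1

lemma prob_exists_sparse_normal_le [Fintype F] [DecidableEq F] (hw : IsWeight w) {q : ℝ} (hq0 : 0 ≤ q)
    (hq1 : q ≤ 1) (hq : ∀ a, w a ≤ q) {k : ℕ} (hk : k ≤ n) (s : ℕ) :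
    prob (prodWeight (prodWeight w)) (fun X : Fin n → Fin n → F => ∃ u : Fin n → F, u ≠ 0 ∧
      #{i | u i ≠ 0} ≤ s ∧ ∀ i : Fin n, i.val < k → X i ⬝ᵥ u = 0) ≤
    n * #{S : Finset (Fin n) | #S ≤ s} * q ^ (k - s) := by
  classical
  have hW := hw.prodWeight (ι := Fin n)
  set U : Finset (Fin n) → (Fin n → Fin n → F) → Submodule F (Fin n → F) := fun S C =>
    Submodule.span F (S.image C ∪
      (univ.filter fun i : Fin n => k ≤ i.val).image fun i => Pi.single i (1 : F) :
        Finset (Fin n → F)) with hU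
  have hcard : #(univ.filter fun i : Fin n => k ≤ i.val) ≤ n - k := by
    have := card_filter_add_card_filter_not (s := (univ : Finset (Fin n)))
      (fun i => i.val < k)
    have h2 : #(univ.filter fun i : Fin n => i.val < k) = k := by
      rw [Fin.card_filter_val_lt, min_eq_right hk]
    simp only [not_lt, card_univ, Fintype.card_fin] at this
    omega
  have hone : ∀ j : Fin n, ∀ S : Finset (Fin n), #S ≤ s →
      prob (prodWeight (prodWeight w)) (fun C : Fin n → Fin n → F => j ∉ S ∧ C j ∈ U S C) ≤
        q ^ (k - s) := by
    intro j S hS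
    unfold prob
    rw [expect_resample hW j]
    refine (expect_mono hW.prodWeight fun C => ?_).trans_eq (expect_const hW.prodWeight _)
    have hfin : finrank F (U S C) ≤ s + (n - k) :=
      (finrank_span_finset_le_card _).trans ((card_union_le _ _).trans
        (add_le_add (card_image_le.trans hS) (card_image_le.trans hcard)))
    have hexp : n - (s + (n - k)) = k - s := by omega
    rw [← hexp]
    refine le_trans (expect_mono hW fun x => ind_mono ?_)
      (prob_mem_submodule_le_of_finrank_le hw hq0 hq1 hq (U S C) hfin)
    rintro ⟨hj, hx⟩
    have : S.image (Function.update C j x) = S.image C := by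
      refine image_congr fun i hi => ?_
      rw [Function.update_of_ne]
      rintro rfl
      exact hj hi
    simpa only [hU, this, Function.update_self] using hx
  calc _ ≤ prob (prodWeight (prodWeight w)) (fun X : Fin n → Fin n → F =>
        ∃ a ∈ (univ : Finset (Fin n)) ×ˢ univ.filter fun S : Finset (Fin n) => #S ≤ s,
          a.1 ∉ a.2 ∧ (fun i => X i a.1) ∈ U a.2 fun j i => X i j) := by
        refine prob_mono hW.prodWeight ?_
        rintro X ⟨u, hu, hs, hX⟩
        obtain ⟨j, S, hS, hj, h⟩ := exists_column_mem_span hu hs hX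
        exact ⟨(j, S), by simpa using hS, hj, h⟩
    _ ≤ ∑ a ∈ (univ : Finset (Fin n)) ×ˢ univ.filter fun S : Finset (Fin n) => #S ≤ s,
          q ^ (k - s) := by
        refine (prob_exists_le hW.prodWeight _ _).trans (sum_le_sum fun a ha => ?_)
        refine le_trans (le_of_eq ?_) (hone a.1 a.2 (by simpa using ha))
        unfold prob
        rw [expect_transpose]
    _ = _ := by
        rw [sum_const, card_product, nsmul_eq_mul, card_univ, Fintype.card_fin]
        push_cast
        ring

lemma card_filter_card_le_mul (n s : ℕ) :
    (#{S : Finset (Fin n) | #S ≤ s} : ℝ) ≤ 16 ^ s * (17 / 16) ^ n := by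
  have h := Finset.sum_pow_mul_eq_add_pow (1 / 16 : ℝ) 1 (univ : Finset (Fin n))
  simp only [one_pow, mul_one, card_univ, Fintype.card_fin, powerset_univ] at h
  have h2 : (#{S : Finset (Fin n) | #S ≤ s} : ℝ) * (1 / 16) ^ s ≤
      ∑ S : Finset (Fin n), (1 / 16 : ℝ) ^ #S := by
    rw [← nsmul_eq_mul, ← sum_const]
    refine (sum_le_sum fun S hS => ?_).trans
      (sum_le_sum_of_subset_of_nonneg (filter_subset _ _) fun _ _ _ => by positivity)
    exact pow_le_pow_of_le_one (by norm_num) (by norm_num) (mem_filter.1 hS).2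
  rw [h, one_div, inv_pow, ← div_eq_mul_inv, div_le_iff₀ (by positivity)] at h2
  norm_num at h2 ⊢
  linarith

end SparseNormal

end DetDivisors

namespace DetDivisors

open Finset Module

lemma linearIndepOn_of_forall_notMem_span {F E : Type*} [Field F] [AddCommGroup E] [Module F E]
    {n : ℕ} {X : Fin n → E} (h : ∀ i, LinearIndepOn F X (Iio i : Finset (Fin n)) →
      X i ∉ Submodule.span F (X '' (Iio i : Finset (Fin n)))) (k : ℕ) :
    LinearIndepOn F X {i | i.val < k} := by
  induction k with
  | zero => simp
  | succ k ih =>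
    by_cases hk : k < n
    · have h1 : {i : Fin n | i.val < k} = ((Iio ⟨k, hk⟩ : Finset (Fin n)) : Set (Fin n)) := by
        ext i
        simp [Fin.lt_def]
      have h2 : {i : Fin n | i.val < k + 1} = insert ⟨k, hk⟩ {i : Fin n | i.val < k} := by
        ext i
        simp only [Set.mem_ofPred_eq, Set.mem_insert_iff, Fin.ext_iff]
        omega
      rw [h2]
      rw [h1] at ih ⊢
      exact ih.insert (h _ ih)
    · have h2 : {i : Fin n | i.val < k + 1} = {i : Fin n | i.val < k} := by
        ext i
        simp only [Set.mem_ofPred_eq]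
        omega
      rwa [h2]

lemma exists_mem_span_Iio {F E : Type*} [Field F] [AddCommGroup E] [Module F E]
    {n : ℕ} {X : Fin n → E} (hX : ¬ LinearIndependent F X) :
    ∃ i, LinearIndepOn F X (Iio i : Finset (Fin n)) ∧
      X i ∈ Submodule.span F (X '' (Iio i : Finset (Fin n))) := by
  by_contra! h
  have := linearIndepOn_of_forall_notMem_span h n
  refine hX (linearIndepOn_univ_iff.1 ?_)
  convert this
  ext i
  simp

section Rows

variable {F : Type*} [Field F] [Fintype F] {w : F → ℝ} {n : ℕ}

lemma prob_row_mem_span_le (hw : IsWeight w) {i : Fin n}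
    {good : Submodule F (Fin n → F) → Prop} {b : ℝ} (hb : 0 ≤ b)
    (h : ∀ V : Submodule F (Fin n → F), finrank F V ≤ i → good V → prob (prodWeight w) (· ∈ V) ≤ b) :
    prob (prodWeight (prodWeight w)) (fun X : Fin n → Fin n → F =>
      good (Submodule.span F (X '' (Iio i : Finset (Fin n)))) ∧
        X i ∈ Submodule.span F (X '' (Iio i : Finset (Fin n)))) ≤ b := by
  classical
  have hW := hw.prodWeight (ι := Fin n)
  unfold prob
  rw [expect_resample hW i]
  refine (expect_mono hW.prodWeight fun X => ?_).trans_eq (expect_const hW.prodWeight _)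
  have himg : ∀ x, Function.update X i x '' (Iio i : Finset (Fin n)) =
      X '' (Iio i : Finset (Fin n)) := by
    intro x
    refine Set.image_congr fun j hj => ?_
    rw [Function.update_of_ne]
    rintro rfl
    simp at hj
  simp only [himg, Function.update_self]
  set V := Submodule.span F (X '' (Iio i : Finset (Fin n))) with hV
  have hdim : finrank F V ≤ i := by
    rw [hV, ← coe_image]
    refine (finrank_span_finset_le_card _).trans (card_image_le.trans ?_)
    simp
  by_cases hg : good V
  · exact (expect_mono hW fun x => ind_mono And.right).trans (h V hdim hg)
  · refine (expect_mono hW (g := fun _ => 0) fun x => ?_).trans ((expect_const hW 0).trans_le hb)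
    rw [ind_of_false]
    exact fun h => hg h.1

end Rows

section Singular

variable {p : ℕ} [Fact p.Prime] {n : ℕ}

lemma prob_sparse_normal_le_exp :
    prob (prodWeight (prodWeight (entryWeight p (1 / 4)))) (fun X : Fin n → Fin n → ZMod p =>
      ∃ u : Fin n → ZMod p, u ≠ 0 ∧ #{i | u i ≠ 0} ≤ n / 64 ∧
        ∀ i : Fin n, i.val < n - n / 2 → X i ⬝ᵥ u = 0) ≤ n * Real.exp (-(n / 2 ^ 27)) := by
  have hw : IsWeight (entryWeight p (1 / 4)) := isWeight_entryWeight (by norm_num) le_rfl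
  refine (prob_exists_sparse_normal_le hw (q := 1 / 2) (by norm_num) (by norm_num)
    (fun a => (entryWeight_le le_rfl a).trans (by norm_num)) (Nat.sub_le _ _) _).trans ?_
  rw [mul_assoc]
  refine mul_le_mul_of_nonneg_left ?_ (Nat.cast_nonneg n)
  have hs : ((n / 64 : ℕ) : ℝ) ≤ n / 64 := by exact_mod_cast Nat.cast_div_le
  have hk : (n : ℝ) / 2 - n / 64 ≤ ((n - n / 2 - n / 64 : ℕ) : ℝ) := by
    have h1 : 31 * n ≤ 64 * (n - n / 2 - n / 64) := by omega
    have h2 : (31 : ℝ) * n ≤ 64 * ((n - n / 2 - n / 64 : ℕ) : ℝ) := by exact_mod_cast h1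
    linarith
  have hl1 := Real.log_two_gt_d9
  have hl2 := Real.log_two_lt_d9
  have hn : (0 : ℝ) ≤ n := Nat.cast_nonneg n
  have e1 : (16 : ℝ) ^ (n / 64) ≤ Real.exp (n / 16 * Real.log 2) := by
    have h16 : (16 : ℝ) = Real.exp (4 * Real.log 2) := by
      rw [mul_comm, Real.exp_mul, Real.exp_log two_pos]
      norm_num
    calc (16 : ℝ) ^ (n / 64) = Real.exp ((n / 64 : ℕ) * (4 * Real.log 2)) := by
          rw [h16, ← Real.exp_nat_mul]
      _ ≤ _ := by
          rw [Real.exp_le_exp]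
          nlinarith
  have e2 : (17 / 16 : ℝ) ^ n ≤ Real.exp (n / 16) := by
    have h := Real.add_one_le_exp (1 / 16 : ℝ)
    calc (17 / 16 : ℝ) ^ n ≤ Real.exp (1 / 16) ^ n :=
          pow_le_pow_left₀ (by norm_num) (by linarith) n
      _ = _ := by rw [← Real.exp_nat_mul]; congr 1; ring
  have e3 : (1 / 2 : ℝ) ^ (n - n / 2 - n / 64) ≤ Real.exp (-(n / 2 - n / 64) * Real.log 2) := by
    rw [← Real.exp_log (show (0 : ℝ) < 1 / 2 by norm_num), ← Real.exp_nat_mul, Real.exp_le_exp,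
      one_div, Real.log_inv]
    nlinarith
  calc (#{S : Finset (Fin n) | #S ≤ n / 64} : ℝ) * (1 / 2) ^ (n - n / 2 - n / 64)
      ≤ (Real.exp (n / 16 * Real.log 2) * Real.exp (n / 16)) *
        Real.exp (-(n / 2 - n / 64) * Real.log 2) := by
        refine mul_le_mul ((card_filter_card_le_mul n _).trans ?_) e3 (by positivity)
          (by positivity)
        exact mul_le_mul e1 e2 (by positivity) (by positivity)
    _ ≤ _ := by
        rw [← Real.exp_add, ← Real.exp_add, Real.exp_le_exp]
        nlinarith

/-- No nonzero normal vector of `V` is supported on few coordinates. -/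
def NoSparseNormal (V : Submodule (ZMod p) (Fin n → ZMod p)) : Prop :=
  ∀ u ∈ orth V, u ≠ 0 → n / 64 < #{i | u i ≠ 0}

/-- The subspace `V` has no sparse normal vector, but a random vector lies in it with probability
much larger than expected. -/
def Concentrated (V : Submodule (ZMod p) (Fin n → ZMod p)) : Prop :=
  NoSparseNormal V ∧ 2 * ((p : ℝ) ^ (n - finrank (ZMod p) V))⁻¹ + 4 * Real.exp (-(n / 2 ^ 27)) <
    prob (prodWeight (entryWeight p (1 / 4))) (· ∈ V)

lemma half_pow_le_exp {m n : ℕ} (h : n ≤ 2 * m) : (1 / 2 : ℝ) ^ m ≤ Real.exp (-(n / 2 ^ 27)) := by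
  have he := Real.add_one_le_exp (-(1 / 2) : ℝ)
  refine (pow_le_pow_left₀ (by norm_num) (show (1 / 2 : ℝ) ≤ Real.exp (-(1 / 2)) by linarith)
    m).trans ?_
  rw [← Real.exp_nat_mul, Real.exp_le_exp]
  have hn : (n : ℝ) ≤ 2 * m := by exact_mod_cast h
  linarith

lemma prob_span_concentrated_le (i : Fin n) :
    prob (prodWeight (prodWeight (entryWeight p (1 / 4)))) (fun X : Fin n → Fin n → ZMod p =>
      LinearIndepOn (ZMod p) X (Iio i : Finset (Fin n)) ∧
      Concentrated (Submodule.span (ZMod p) (X '' (Iio i : Finset (Fin n))))) ≤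
      64 * Real.exp (-(n / 2 ^ 27)) := by
  have hw : IsWeight (entryWeight p (1 / 4)) := isWeight_entryWeight (by norm_num) le_rfl
  have hv : IsWeight (entryWeight p (1 / (8 * 4 ^ 10))) :=
    isWeight_entryWeight (by norm_num) (by norm_num)
  refine (prob_span_comparable_le (r := n / 4) (η := (2 ^ 9)⁻¹)
    (q := 1 - 2 * (1 / (8 * 4 ^ 10))) hw hv (by norm_num) (by norm_num)
    (fun a => entryWeight_le (by norm_num) a) (by norm_num) (Iio i) Concentrated ?_).trans ?_
  · rintro V ⟨hV, hlt⟩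
    have hT : ∀ u ∈ orth V, u ≠ 0 → (n / 128 : ℝ) < #{i | u i ≠ 0} / 2 := by
      intro u hu hu0
      have h1 : n < 64 * #{i | u i ≠ 0} := by
        have := hV u hu hu0
        omega
      have h2 : (n : ℝ) < 64 * #{i | u i ≠ 0} := by exact_mod_cast h1
      linarith
    have h1 := prob_mem_le_add hT 10
    have h2 : prob (prodWeight (entryWeight p (1 / 4))) (· ∈ V) ≤
        prob (prodWeight (entryWeight p (1 / (8 * 4 ^ 10)))) (· ∈ V) :=
      prob_mem_anti (by norm_num) le_rfl
    have h3 : (n / 128 / 4 ^ 10 : ℝ) = n / 2 ^ 27 := by ring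
    rw [h3] at h1
    have h4 : 0 ≤ ((p : ℝ) ^ (n - finrank (ZMod p) V))⁻¹ := by positivity
    have h5 : (1 - 2 * (1 / (8 * 4 ^ 10)) : ℝ) ^ (n - n / 4) ≤ Real.exp (-(n / 2 ^ 27)) := by
      have h := Real.add_one_le_exp (-(2 * (1 / (8 * 4 ^ 10))) : ℝ)
      refine (pow_le_pow_left₀ (by norm_num) (show _ ≤ Real.exp (-(2 * (1 / (8 * 4 ^ 10))) : ℝ) by
        linarith) _).trans ?_
      rw [← Real.exp_nat_mul, Real.exp_le_exp]
      have h6 : n ≤ 2 * (n - n / 4) := by omega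
      have h7 : (n : ℝ) ≤ 2 * ((n - n / 4 : ℕ) : ℝ) := by exact_mod_cast h6
      norm_num
      linarith
    have h6 := Real.exp_pos (-(n / 2 ^ 27) : ℝ)
    constructor
    · linarith
    · norm_num at h1 hlt ⊢
      linarith
  · have hi : (2 : ℝ) ^ #(Iio i) ≤ 2 ^ n := by
      rw [Fin.card_Iio]
      exact pow_le_pow_right₀ (by norm_num) i.2.le
    have h1 : (2 * (2 ^ 9)⁻¹ : ℝ) ^ (n / 4) * 2 ^ n ≤ 64 * (1 / 2) ^ n := by
      have h2 : (2 * (2 ^ 9)⁻¹ : ℝ) = (2 ^ 8)⁻¹ := by norm_num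
      rw [h2, inv_pow, ← pow_mul, inv_mul_le_iff₀ (by positivity)]
      have h3 : (64 : ℝ) = 2 ^ 6 := by norm_num
      have h4 : (1 / 2 : ℝ) ^ n * 2 ^ n = 1 := by rw [← mul_pow]; norm_num
      have h5 : (2 : ℝ) ^ n * 2 ^ n ≤ 2 ^ (8 * (n / 4)) * 2 ^ 6 := by
        rw [← pow_add, ← pow_add]
        exact pow_le_pow_right₀ (by norm_num) (by omega)
      have h6 : (0 : ℝ) < 2 ^ n := by positivity
      refine le_of_mul_le_mul_right ?_ h6
      calc (2 : ℝ) ^ n * 2 ^ n ≤ 2 ^ (8 * (n / 4)) * 2 ^ 6 := h5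
        _ = 2 ^ (8 * (n / 4)) * (64 * ((1 / 2) ^ n * 2 ^ n)) := by rw [h4, h3, mul_one]
        _ = _ := by ring
    refine (mul_le_mul_of_nonneg_left hi (by positivity)).trans (h1.trans ?_)
    refine mul_le_mul_of_nonneg_left ?_ (by norm_num)
    exact half_pow_le_exp (by omega)

lemma noSparseNormal_span {X : Fin n → Fin n → ZMod p} {i : Fin n} (hi : n - n / 2 ≤ i.val)
    (hX : ¬ ∃ u : Fin n → ZMod p, u ≠ 0 ∧ #{i | u i ≠ 0} ≤ n / 64 ∧
        ∀ i : Fin n, i.val < n - n / 2 → X i ⬝ᵥ u = 0) :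
    NoSparseNormal (Submodule.span (ZMod p) (X '' (Iio i : Finset (Fin n)))) := by
  intro u hu hu0
  by_contra! hle
  refine hX ⟨u, hu0, hle, fun j hj => ?_⟩
  rw [dotProduct_comm]
  refine mem_orth.1 hu _ (Submodule.subset_span ⟨j, ?_, rfl⟩)
  simp only [coe_Iio, Set.mem_Iio, Fin.lt_def]
  omega

lemma prob_first_dependence_le (i : Fin n) :
    prob (prodWeight (prodWeight (entryWeight p (1 / 4)))) (fun X : Fin n → Fin n → ZMod p =>
      (¬ ∃ u : Fin n → ZMod p, u ≠ 0 ∧ #{i | u i ≠ 0} ≤ n / 64 ∧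
        ∀ i : Fin n, i.val < n - n / 2 → X i ⬝ᵥ u = 0) ∧
      LinearIndepOn (ZMod p) X (Iio i : Finset (Fin n)) ∧
      X i ∈ Submodule.span (ZMod p) (X '' (Iio i : Finset (Fin n)))) ≤
    2 * ((p : ℝ) ^ (n - i))⁻¹ + 68 * Real.exp (-(n / 2 ^ 27)) := by
  have hw : IsWeight (entryWeight p (1 / 4)) := isWeight_entryWeight (by norm_num) le_rfl
  have hW := hw.prodWeight (ι := Fin n)
  have hp : (1 : ℝ) ≤ p := by exact_mod_cast (Fact.out : p.Prime).one_le
  have he := Real.exp_pos (-(n / 2 ^ 27) : ℝ)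
  have hp0 : 0 ≤ ((p : ℝ) ^ (n - i))⁻¹ := by positivity
  by_cases hi : n - n / 2 ≤ i.val
  · have h1 := prob_span_concentrated_le (p := p) i
    have h2 := prob_row_mem_span_le hw (i := i)
      (good := fun V => prob (prodWeight (entryWeight p (1 / 4))) (· ∈ V) ≤
        2 * ((p : ℝ) ^ (n - i))⁻¹ + 4 * Real.exp (-(n / 2 ^ 27)))
      (b := 2 * ((p : ℝ) ^ (n - i))⁻¹ + 4 * Real.exp (-(n / 2 ^ 27))) (by positivity)
      fun V _ h => h
    refine (prob_mono hW.prodWeight (E' := fun X => _ ∨ _) ?_).trans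
      ((prob_or_le hW.prodWeight _ _).trans ((add_le_add h1 h2).trans (by linarith)))
    rintro X ⟨hB, hX, hmem⟩
    have hdim : finrank (ZMod p) (Submodule.span (ZMod p) (X '' (Iio i : Finset (Fin n)))) = i := by
      rw [finrank_span_image_of_linearIndepOn hX, Fin.card_Iio]
    by_cases hle : prob (prodWeight (entryWeight p (1 / 4)))
        (· ∈ Submodule.span (ZMod p) (X '' (Iio i : Finset (Fin n)))) ≤
          2 * ((p : ℝ) ^ (n - i))⁻¹ + 4 * Real.exp (-(n / 2 ^ 27))
    · exact Or.inr ⟨hle, hmem⟩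
    · refine Or.inl ⟨hX, noSparseNormal_span hi hB, ?_⟩
      rw [hdim]
      exact not_le.1 hle
  · have h2 := prob_row_mem_span_le hw (i := i) (good := fun _ => True)
      (b := (1 / 2) ^ (n - i)) (by positivity) fun V hV _ =>
        prob_mem_submodule_le_of_finrank_le hw (by norm_num) (by norm_num)
          (fun a => (entryWeight_le le_rfl a).trans (by norm_num)) V hV
    refine (prob_mono hW.prodWeight fun X hX => ⟨trivial, hX.2.2⟩).trans (h2.trans ?_)
    have h3 := half_pow_le_exp (n := n) (m := n - i) (by omega)
    linarith

lemma sum_inv_pow_le {x : ℝ} (hx : 2 ≤ x) (n : ℕ) :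
    ∑ i : Fin n, (x ^ (n - i))⁻¹ ≤ 2 / x := by
  have hx0 : x⁻¹ ≤ 1 / 2 := by
    rw [inv_le_comm₀ (by linarith) (by norm_num)]
    linarith
  have hx1 : 0 < x⁻¹ := inv_pos.2 (by linarith)
  induction n with
  | zero =>
    simp only [univ_eq_empty, sum_empty]
    positivity
  | succ n ih =>
    have h : ∀ i : Fin n, (x ^ (n + 1 - (i.castSucc : ℕ)))⁻¹ = x⁻¹ * (x ^ (n - i))⁻¹ := by
      intro i
      rw [Fin.val_castSucc, Nat.succ_sub i.2.le, pow_succ', mul_inv]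
    rw [Fin.sum_univ_castSucc, sum_congr rfl fun i _ => h i, ← mul_sum]
    simp only [Fin.val_last, Nat.add_sub_cancel_left, pow_one]
    rw [div_eq_mul_inv] at ih ⊢
    nlinarith

/-- The determinant of a random sparse sign matrix vanishes modulo a prime `p` with probability
`O(1/p)`, up to an exponentially small error. -/
lemma prob_det_eq_zero_le (n p : ℕ) [Fact p.Prime] :
    prob (prodWeight (prodWeight (entryWeight p (1 / 4))))
      (fun X : Fin n → Fin n → ZMod p => (Matrix.of X).det = 0) ≤
    4 / p + 69 * n * Real.exp (-(n / 2 ^ 27)) := by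
  have hw : IsWeight (entryWeight p (1 / 4)) := isWeight_entryWeight (by norm_num) le_rfl
  have hW := hw.prodWeight (ι := Fin n)
  have hp : (2 : ℝ) ≤ p := by exact_mod_cast (Fact.out : p.Prime).two_le
  refine (prob_mono hW.prodWeight (E' := fun X => _ ∨ ∃ i ∈ univ, _) ?_).trans
    ((prob_or_le hW.prodWeight _ _).trans ((add_le_add prob_sparse_normal_le_exp
      ((prob_exists_le hW.prodWeight _ _).trans
        (sum_le_sum fun i _ => prob_first_dependence_le i))).trans ?_))
  · intro X hX
    by_cases hB : ∃ u : Fin n → ZMod p, u ≠ 0 ∧ #{i | u i ≠ 0} ≤ n / 64 ∧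
        ∀ i : Fin n, i.val < n - n / 2 → X i ⬝ᵥ u = 0
    · exact Or.inl hB
    · have hdep : ¬ LinearIndependent (ZMod p) X := by
        intro hlin
        have := (Matrix.linearIndependent_rows_iff_isUnit (A := Matrix.of X)).1 hlin
        rw [Matrix.isUnit_iff_isUnit_det, hX] at this
        exact not_isUnit_zero this
      obtain ⟨i, hi1, hi2⟩ := exists_mem_span_Iio hdep
      exact Or.inr ⟨i, mem_univ i, hB, hi1, hi2⟩
  · rw [sum_add_distrib, ← mul_sum, sum_const, card_univ, Fintype.card_fin, nsmul_eq_mul]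
    have h := sum_inv_pow_le hp n
    have h2 : (4 : ℝ) / p = 2 * (2 / p) := by ring
    rw [h2]
    nlinarith

end Singular

end DetDivisors

namespace DetDivisors

open Finset Module

/-- The four equally likely outcomes producing an entry. -/
def entryOutcome : Fin 4 → ℤ := ![0, 0, 1, -1]

lemma map_entryOutcome :
    ((4⁻¹ : ENNReal) • (Measure.count : Measure (Fin 4))).map entryOutcome = entryMeasure := by
  have h4 : (4⁻¹ + 4⁻¹ : ENNReal) = 2⁻¹ := by
    rw [← two_mul, show (4 : ENNReal) = 2 * 2 by norm_num,
      ENNReal.mul_inv (by norm_num) (by norm_num), ← mul_assoc,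
      ENNReal.mul_inv_cancel (by norm_num) (by norm_num), one_mul]
  have hcount : (Measure.count : Measure (Fin 4)) = Measure.dirac 0 + Measure.dirac 1 +
      Measure.dirac 2 + Measure.dirac 3 := by
    rw [Measure.count, Measure.sum_fintype, Fin.sum_univ_four]
  have hm : Measurable entryOutcome := Measurable.of_discrete
  rw [hcount, Measure.map_smul, Measure.map_add _ _ hm, Measure.map_add _ _ hm,
    Measure.map_add _ _ hm, Measure.map_dirac' hm, Measure.map_dirac' hm, Measure.map_dirac' hm,
    Measure.map_dirac' hm, entryMeasure]
  simp only [entryOutcome, Matrix.cons_val, one_div, smul_add, ← h4, add_smul]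

instance : IsProbabilityMeasure ((4⁻¹ : ENNReal) • (Measure.count : Measure (Fin 4))) := by
  constructor
  simp [Measure.count_apply, ENNReal.inv_mul_cancel]

lemma integral_matMeasure (n : ℕ) (f : (Fin n → Fin n → ℤ) → ℝ) :
    ∫ M, f M ∂(matMeasure n) = expect (prodWeight (prodWeight fun _ : Fin 4 => (1 / 4 : ℝ)))
      fun x : Fin n → Fin n → Fin 4 => f fun i j => entryOutcome (x i j) := by
  have hvec : vecMeasure n =
      (Measure.pi fun _ => (4⁻¹ : ENNReal) • (Measure.count : Measure (Fin 4))).map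
        fun x i => entryOutcome (x i) := by
    rw [vecMeasure, ← map_entryOutcome]
    exact (Measure.pi_map_pi fun _ => Measurable.of_discrete.aemeasurable).symm
  have hmat : matMeasure n =
      (Measure.pi fun _ => Measure.pi fun _ =>
        (4⁻¹ : ENNReal) • (Measure.count : Measure (Fin 4))).map
        fun x i j => entryOutcome (x i j) := by
    rw [matMeasure, hvec]
    exact (Measure.pi_map_pi fun _ => Measurable.of_discrete.aemeasurable).symm
  rw [hmat, integral_map Measurable.of_discrete.aemeasurable
    Measurable.of_discrete.aestronglyMeasurable, integral_fintype .of_finite]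
  unfold expect prodWeight
  refine sum_congr rfl fun x _ => ?_
  rw [smul_eq_mul]
  congr 1
  simp [Measure.real, Measure.pi_singleton]

lemma mapWeight_entryOutcome (p : ℕ) [Fact p.Prime] :
    mapWeight (fun a => (entryOutcome a : ZMod p)) (fun _ : Fin 4 => (1 / 4 : ℝ)) =
      entryWeight p (1 / 4) := by
  ext a
  unfold mapWeight entryWeight
  rw [sum_filter, Fin.sum_univ_four]
  simp only [entryOutcome, Matrix.cons_val, Int.cast_zero, Int.cast_one, Int.cast_neg, eq_comm]
  split_ifs <;> norm_num

lemma isWeight_quarter : IsWeight fun _ : Fin 4 => (1 / 4 : ℝ) where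
  nonneg _ := by norm_num
  sum_eq_one := by simp

/-- The integer matrix determined by a choice of outcomes for the entries. -/
def outcomeMatrix {n : ℕ} (x : Fin n → Fin n → Fin 4) : Matrix (Fin n) (Fin n) ℤ :=
  Matrix.of fun i j => entryOutcome (x i j)

lemma prob_dvd_det_le (n p : ℕ) [Fact p.Prime] :
    prob (prodWeight (prodWeight fun _ : Fin 4 => (1 / 4 : ℝ)))
      (fun x : Fin n → Fin n → Fin 4 => p ∣ (outcomeMatrix x).det.natAbs) ≤
    4 / p + 69 * n * Real.exp (-(n / 2 ^ 27)) := by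
  refine le_trans (le_of_eq ?_) (prob_det_eq_zero_le n p)
  unfold prob
  rw [← mapWeight_entryOutcome, prodWeight_mapWeight, prodWeight_mapWeight, expect_mapWeight]
  congr 1
  ext x
  congr 1
  change (p ∣ (outcomeMatrix x).det.natAbs) =
    ((Matrix.of fun i j => (entryOutcome (x i j) : ZMod p)).det = 0)
  rw [← Int.natCast_dvd, ← ZMod.intCast_zmod_eq_zero_iff_dvd, ← eq_intCast (Int.castRingHom (ZMod p)),
    RingHom.map_det]
  rfl

lemma natAbs_det_le (n : ℕ) (x : Fin n → Fin n → Fin 4) :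
    (outcomeMatrix x).det.natAbs ≤ n ^ n := by
  have h := Matrix.det_le (A := outcomeMatrix x) (abv := AbsoluteValue.abs) (x := 1) fun i j => by
    have : ∀ a, |entryOutcome a| ≤ 1 := by decide
    exact this _
  simp only [AbsoluteValue.abs_apply, one_pow, Fintype.card_fin, nsmul_eq_mul, mul_one] at h
  have h2 : (outcomeMatrix x).det.natAbs ≤ n.factorial := by
    rw [← Int.natCast_natAbs] at h
    exact_mod_cast h
  exact h2.trans (Nat.factorial_le_pow n)

end DetDivisors

namespace DetDivisors

open Finset Module

section Divisors

variable {n D : ℕ}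

lemma log_card_divisors_le (hn : 2 ≤ n) (hD : D ≠ 0) (hDn : D ≤ n ^ n) :
    Real.log (D.divisors.card : ℝ) ≤ 2 * Real.log n * #D.primeFactors := by
  rw [Nat.card_divisors hD, Nat.cast_prod, Real.log_prod fun p _ => by positivity]
  refine (sum_le_card_nsmul _ _ (2 * Real.log n) fun p hp => ?_).trans_eq (by
    rw [nsmul_eq_mul, mul_comm])
  have hpp := Nat.prime_of_mem_primeFactors hp
  have h1 : 2 ^ D.factorization p ≤ 2 ^ ((n - 1) * n) :=
    calc 2 ^ D.factorization p ≤ p ^ D.factorization p := Nat.pow_le_pow_left hpp.two_le _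
      _ ≤ D := Nat.ordProj_le p hD
      _ ≤ n ^ n := hDn
      _ ≤ (2 ^ (n - 1)) ^ n := by
        refine Nat.pow_le_pow_left ?_ n
        have := Nat.lt_two_pow_self (n := n - 1)
        omega
      _ = _ := (pow_mul _ _ _).symm
  have h2 : D.factorization p + 1 ≤ n ^ 2 := by
    have h3 := (Nat.pow_le_pow_iff_right (by norm_num)).1 h1
    obtain ⟨m, rfl⟩ := Nat.exists_eq_add_of_le hn
    have h4 : 2 + m - 1 = m + 1 := by omega
    rw [h4] at h3
    nlinarith
  calc Real.log ((D.factorization p + 1 : ℕ) : ℝ) ≤ Real.log ((n ^ 2 : ℕ) : ℝ) :=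
        Real.log_le_log (by positivity) (by exact_mod_cast h2)
    _ = _ := by rw [Nat.cast_pow, Real.log_pow]; norm_num

lemma card_large_primeFactors_le (hD : D ≠ 0) (hDn : D ≤ n ^ n) (L : ℕ) :
    #{p ∈ D.primeFactors | 2 ^ L ≤ p} * (L * Real.log 2) ≤ n * Real.log n := by
  have h1 : (2 ^ L) ^ #{p ∈ D.primeFactors | 2 ^ L ≤ p} ≤ n ^ n :=
    calc (2 ^ L) ^ #{p ∈ D.primeFactors | 2 ^ L ≤ p}
        ≤ ∏ p ∈ D.primeFactors with 2 ^ L ≤ p, p :=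
          pow_card_le_prod _ _ _ fun p hp => (mem_filter.1 hp).2
      _ ≤ D := Nat.le_of_dvd (Nat.pos_of_ne_zero hD)
          ((prod_dvd_prod_of_subset _ _ _ (filter_subset _ _)).trans (Nat.prod_primeFactors_dvd D))
      _ ≤ n ^ n := hDn
  have h2 : Real.log (((2 ^ L) ^ #{p ∈ D.primeFactors | 2 ^ L ≤ p} : ℕ) : ℝ) ≤
      Real.log ((n ^ n : ℕ) : ℝ) := Real.log_le_log (by positivity) (by exact_mod_cast h1)
  push_cast at h2
  rwa [Real.log_pow, Real.log_pow, Real.log_pow] at h2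

lemma card_primes_dyadic_le (k : ℕ) :
    #{p ∈ Ico (2 ^ k) (2 ^ (k + 1)) | p.Prime} * k ≤ 4 * 2 ^ k := by
  have h1 : 2 ^ (#{p ∈ Ico (2 ^ k) (2 ^ (k + 1)) | p.Prime} * k) ≤ 2 ^ (4 * 2 ^ k) :=
    calc 2 ^ (#{p ∈ Ico (2 ^ k) (2 ^ (k + 1)) | p.Prime} * k)
        = (2 ^ k) ^ #{p ∈ Ico (2 ^ k) (2 ^ (k + 1)) | p.Prime} := by rw [mul_comm, pow_mul]
      _ ≤ ∏ p ∈ Ico (2 ^ k) (2 ^ (k + 1)) with p.Prime, p :=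
          pow_card_le_prod _ _ _ fun p hp => (mem_Ico.1 (mem_filter.1 hp).1).1
      _ ≤ primorial (2 ^ (k + 1)) := by
          refine prod_le_prod_of_subset_of_one_le' (fun p hp => ?_)
            fun p hp _ => (mem_filter.1 hp).2.one_le
          simp only [mem_filter, mem_Ico, mem_range] at hp ⊢
          exact ⟨by omega, hp.2⟩
      _ ≤ 4 ^ 2 ^ (k + 1) := primorial_le_four_pow _
      _ = 2 ^ (4 * 2 ^ k) := by
          rw [show 4 = 2 ^ 2 by norm_num, ← pow_mul]
          congr 1
          ring
  exact (Nat.pow_le_pow_iff_right (by norm_num)).1 h1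

lemma sum_inv_primes_le (L : ℕ) :
    ∑ p ∈ range (2 ^ L) with p.Prime, (p : ℝ)⁻¹ ≤ 4 * ∑ k ∈ range L, (k : ℝ)⁻¹ := by
  induction L with
  | zero => simp [filter_singleton, Nat.not_prime_zero]
  | succ L ih =>
    have hle : 2 ^ L ≤ 2 ^ (L + 1) := Nat.pow_le_pow_right (by norm_num) L.le_succ
    rw [sum_range_succ, mul_add, range_eq_Ico, ← Ico_union_Ico_eq_Ico (Nat.zero_le _) hle,
      filter_union, sum_union (disjoint_filter_filter (Ico_disjoint_Ico_consecutive _ _ _)),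
      ← range_eq_Ico]
    refine add_le_add ih ?_
    rcases Nat.eq_zero_or_pos L with rfl | hL
    · simp [filter_singleton, Nat.not_prime_one]
    · have hL' : (0 : ℝ) < L := by exact_mod_cast hL
      have h1 : (#{p ∈ Ico (2 ^ L) (2 ^ (L + 1)) | p.Prime} : ℝ) * L ≤ 4 * 2 ^ L := by
        exact_mod_cast card_primes_dyadic_le L
      calc ∑ p ∈ Ico (2 ^ L) (2 ^ (L + 1)) with Nat.Prime p, (p : ℝ)⁻¹
          ≤ #{p ∈ Ico (2 ^ L) (2 ^ (L + 1)) | p.Prime} • ((2 : ℝ) ^ L)⁻¹ := by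
            refine sum_le_card_nsmul _ _ _ fun p hp => ?_
            refine inv_anti₀ (by positivity) ?_
            exact_mod_cast (mem_Ico.1 (mem_filter.1 hp).1).1
        _ ≤ 4 * (L : ℝ)⁻¹ := by
            rw [nsmul_eq_mul, ← div_eq_mul_inv, ← div_eq_mul_inv,
              div_le_div_iff₀ (by positivity) hL']
            exact h1

lemma sum_inv_primes_le_log {L : ℕ} (hL : L ≤ n) :
    ∑ p ∈ range (2 ^ L) with p.Prime, (p : ℝ)⁻¹ ≤ 4 * (1 + Real.log n) := by
  refine (sum_inv_primes_le L).trans (mul_le_mul_of_nonneg_left ?_ (by norm_num))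
  refine le_trans ?_ (harmonic_le_one_add_log n)
  rw [harmonic]
  push_cast
  have h : ∑ k ∈ range (n + 1), (k : ℝ)⁻¹ = ∑ k ∈ range n, ((k : ℝ) + 1)⁻¹ := by
    rw [sum_range_succ']
    simp
  rw [← h]
  exact sum_le_sum_of_subset_of_nonneg (range_subset_range.2 (by omega))
    fun _ _ _ => by positivity

lemma log_card_divisors_le_sum (hn : 2 ≤ n) (hDn : D ≤ n ^ n) {L : ℕ}
    (hL : (n : ℝ) / 2 ^ 27 ≤ L) :
    Real.log (D.divisors.card : ℝ) ≤ 2 * Real.log n *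
      (∑ p ∈ range (2 ^ L) with p.Prime, ind (p ∣ D) + 2 ^ 28 * Real.log n) := by
  have hlog : 0 ≤ Real.log n := Real.log_natCast_nonneg n
  have hind : 0 ≤ ∑ p ∈ range (2 ^ L) with p.Prime, ind (p ∣ D) :=
    sum_nonneg fun _ _ => ind_nonneg _
  by_cases hD : D = 0
  · subst hD
    simp only [Nat.divisors_zero, card_empty, Nat.cast_zero, Real.log_zero]
    positivity
  refine (log_card_divisors_le hn hD hDn).trans (mul_le_mul_of_nonneg_left ?_ (by positivity))
  rw [← card_filter_add_card_filter_not (s := D.primeFactors) fun p => 2 ^ L ≤ p, Nat.cast_add,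
    add_comm]
  refine add_le_add ?_ ?_
  · rw [card_eq_sum_ones, Nat.cast_sum]
    refine (sum_le_sum fun p hp => ?_).trans (sum_le_sum_of_subset_of_nonneg
      (t := {p ∈ range (2 ^ L) | p.Prime}) (fun p hp => ?_) fun _ _ _ => ind_nonneg (_ ∣ D))
    · rw [ind_of_true (Nat.dvd_of_mem_primeFactors (mem_filter.1 hp).1), Nat.cast_one]
    · simp only [mem_filter, mem_range, not_le] at hp ⊢
      exact ⟨hp.2, Nat.prime_of_mem_primeFactors hp.1⟩
  · have h1 := card_large_primeFactors_le hD hDn L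
    set m : ℝ := (#{p ∈ D.primeFactors | 2 ^ L ≤ p} : ℝ)
    have hm : 0 ≤ m := Nat.cast_nonneg _
    have hn0 : (0 : ℝ) < n := by positivity
    have hl2 := Real.log_two_gt_d9
    have h2 : (n : ℝ) / 2 ^ 28 ≤ L * Real.log 2 := by nlinarith
    have h3 : n * m ≤ n * (2 ^ 28 * Real.log n) := by
      have := mul_le_mul_of_nonneg_left h2 hm
      linarith
    exact le_of_mul_le_mul_left h3 hn0

end Divisors

lemma two_pow_mul_exp_le (n : ℕ) :
    (2 : ℝ) ^ (n / 2 ^ 27 + 1) * (69 * n * Real.exp (-(n / 2 ^ 27))) ≤ 2 ^ 37 := by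
  have hL : ((n / 2 ^ 27 : ℕ) : ℝ) ≤ n / 2 ^ 27 := by exact_mod_cast Nat.cast_div_le
  have hl2 := Real.log_two_lt_d9
  have hl0 : 0 < Real.log 2 := Real.log_pos (by norm_num)
  have hn : (0 : ℝ) ≤ n := Nat.cast_nonneg n
  set x : ℝ := n / 2 ^ 27 with hx
  have hx0 : 0 ≤ x := by positivity
  have h1 : (2 : ℝ) ^ (n / 2 ^ 27) ≤ Real.exp (3 / 4 * x) := by
    rw [← Real.exp_log two_pos, ← Real.exp_nat_mul, Real.exp_le_exp]
    nlinarith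
  have h2 : Real.exp (3 / 4 * x) * Real.exp (-x) = (Real.exp (x / 4))⁻¹ := by
    rw [← Real.exp_add, ← Real.exp_neg]
    congr 1
    ring
  have h3 : x / 4 * (Real.exp (x / 4))⁻¹ ≤ 1 := by
    rw [← div_eq_mul_inv, div_le_one (Real.exp_pos _)]
    linarith [Real.add_one_le_exp (x / 4)]
  have hn' : (n : ℝ) = 2 ^ 27 * x := by rw [hx]; ring
  calc (2 : ℝ) ^ (n / 2 ^ 27 + 1) * (69 * n * Real.exp (-x))
      = 138 * n * ((2 : ℝ) ^ (n / 2 ^ 27) * Real.exp (-x)) := by ring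
    _ ≤ 138 * n * (Real.exp (3 / 4 * x) * Real.exp (-x)) := by gcongr
    _ = 138 * 4 * 2 ^ 27 * (x / 4 * (Real.exp (x / 4))⁻¹) := by rw [h2, hn']; ring
    _ ≤ 138 * 4 * 2 ^ 27 * 1 := by gcongr
    _ ≤ 2 ^ 37 := by norm_num

lemma sum_prob_dvd_det_le {n L : ℕ} (hn : 2 ≤ n) (hL : L = n / 2 ^ 27 + 1) :
    ∑ p ∈ range (2 ^ L) with p.Prime,
      prob (prodWeight (prodWeight fun _ : Fin 4 => (1 / 4 : ℝ)))
        (fun x : Fin n → Fin n → Fin 4 => p ∣ (outcomeMatrix x).det.natAbs) ≤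
    16 * (1 + Real.log n) + 2 ^ 37 := by
  set e : ℝ := 69 * n * Real.exp (-(n / 2 ^ 27)) with he
  have he0 : 0 ≤ e := by positivity
  calc _ ≤ ∑ p ∈ range (2 ^ L) with p.Prime, (4 * (p : ℝ)⁻¹ + e) := by
        refine sum_le_sum fun p hp => ?_
        have : Fact p.Prime := ⟨(mem_filter.1 hp).2⟩
        rw [← div_eq_mul_inv]
        exact prob_dvd_det_le n p
    _ ≤ 4 * (4 * (1 + Real.log n)) + 2 ^ L * e := by
        rw [sum_add_distrib, ← mul_sum, sum_const, nsmul_eq_mul]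
        refine add_le_add (mul_le_mul_of_nonneg_left (sum_inv_primes_le_log (by omega))
          (by norm_num)) (mul_le_mul_of_nonneg_right ?_ he0)
        have := (card_filter_le (range (2 ^ L)) Nat.Prime).trans_eq (card_range _)
        exact_mod_cast this
    _ ≤ _ := by
        have := two_pow_mul_exp_le n
        rw [hL, he]
        linarith

lemma integral_log_card_divisors_det_le {n : ℕ} (hn : 2 ≤ n) :
    (∫ M, Real.log ((Matrix.of M).det.natAbs.divisors.card : ℝ) ∂(matMeasure n)) ≤
      2 ^ 40 * Real.log n ^ 2 := by
  have hw := isWeight_quarter.prodWeight (ι := Fin n)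
  have hW := hw.prodWeight (ι := Fin n)
  have hL : (n : ℝ) / 2 ^ 27 ≤ ((n / 2 ^ 27 + 1 : ℕ) : ℝ) := by
    have h1 : n ≤ 2 ^ 27 * (n / 2 ^ 27 + 1) := by omega
    rw [div_le_iff₀' (by norm_num)]
    exact_mod_cast h1
  have hlog : (1 / 2 : ℝ) ≤ Real.log n := by
    have h1 : Real.log 2 ≤ Real.log n := Real.log_le_log two_pos (by exact_mod_cast hn)
    linarith [Real.log_two_gt_d9]
  rw [integral_matMeasure]
  refine (expect_mono hW fun x => log_card_divisors_le_sum hn (natAbs_det_le n x) hL).trans ?_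
  rw [expect_mul_left, expect_add, expect_const hW, expect_sum]
  have h := sum_prob_dvd_det_le hn rfl
  unfold prob at h
  calc _ ≤ 2 * Real.log n * (16 * (1 + Real.log n) + 2 ^ 37 + 2 ^ 28 * Real.log n) := by
        gcongr
    _ ≤ _ := by nlinarith

end DetDivisors

/-- Let `X` be the number of positive divisors of `det M` (with `X = 1` when
`det M = 0`).  Then `𝔼[log X] ≤ C (log n)²` for an absolute constant `C > 0`.
Note that `Int.natAbs (0) = 0` has an empty divisor set, so the integrand
`log (card (divisors …))` is `log 0 = 0 = log 1`, matching the convention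
`X = 1` on the event `det M = 0`. -/
theorem expected_log_divisors_det_le :
    ∃ C : ℝ, 0 < C ∧ ∀ n : ℕ, 2 ≤ n →
      (∫ M, Real.log ((Matrix.of M).det.natAbs.divisors.card : ℝ)
          ∂(matMeasure n)) ≤ C * Real.log n ^ 2 := by
  exact ⟨2 ^ 40, by norm_num, fun _ => DetDivisors.integral_log_card_divisors_det_le⟩
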